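/- Let (T,d) be a compact metric space and m a Borel probability measure on T. Let φ and ψ be Young functions with φ(1)=ψ(1)=1, and suppose there exist R>1 and an integer n₀≥1 such that (i) φ(R^k)/φ(R^{k+1}) ≤ φ(R^{k-1})/φ(R^k) for all integers k≥1, and (ii) Σ_{k=0}^{∞} φ(R^k)/ψ(R^{k+n₀}) < ∞. Assume moreover that ψ(x)ψ(y) ≤ ψ(rxy) for all x,y ≥ 1, for some r > 1. Then there exists a constant K ∈ (0,∞) depending only on φ, ψ, R, n₀ such that for every probability space (Ω,F,P) and every stochastic process X : Ω × T → ℝ with continuous sample paths and ψ-bounded increments: E[ sup_{s,t∈T, s≠t} ψ( |X(·,s)−X(·,t)| / (2K τ_{m,φ}(s,t)) ) ] ≤ 1. -/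

import Mathlib

open MeasureTheory ENNReal Filter

noncomputable section

/-- A (finite) Young function: an increasing convex function `φ : [0,∞) → [0,∞)`
with `φ 0 = 0` and `φ x → ∞` as `x → ∞`. -/
def IsYoungFunction (φ : ℝ → ℝ) : Prop :=
  MonotoneOn φ (Set.Ici 0) ∧ ConvexOn ℝ (Set.Ici 0) φ ∧ φ 0 = 0 ∧
    Tendsto φ atTop atTop

/-- Generalized inverse of a Young function, as a map `ℝ≥0∞ → ℝ≥0∞`
(so that in particular `φ⁻¹(∞) = ∞`). -/
def yinv (φ : ℝ → ℝ) (y : ℝ≥0∞) : ℝ≥0∞ :=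
  sInf {x : ℝ≥0∞ | ∃ r : ℝ, 0 ≤ r ∧ x = ENNReal.ofReal r ∧ y ≤ ENNReal.ofReal (φ r)}

/-- The minorizing metric
`τ_{m,φ}(s,t) = max_{x ∈ {s,t}} ∫_0^{d(s,t)} φ⁻¹(1 / m(B(x,ε))) dε`,
with the conventions `1/0 = ∞`, `φ⁻¹(∞) = ∞`. -/
def tauDist {T : Type*} [MetricSpace T] [MeasurableSpace T]
    (m : Measure T) (φ : ℝ → ℝ) (s t : T) : ℝ≥0∞ :=
  max (∫⁻ ε in Set.Ioc (0 : ℝ) (dist s t), yinv φ (1 / m (Metric.closedBall s ε)))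
    (∫⁻ ε in Set.Ioc (0 : ℝ) (dist s t), yinv φ (1 / m (Metric.closedBall t ε)))

/-- `f^d(u,v) = |f(u) - f(v)| / d(u,v)`, equal to `0` on the diagonal. -/
def fdiv {T : Type*} [MetricSpace T] (f : T → ℝ) (p : T × T) : ℝ :=
  |f p.1 - f p.2| / dist p.1 p.2

/-- The Luxemburg norm `|g|^ν_χ = inf {a > 0 : ∫ χ(|g|/a) dν ≤ 1}`, with value `∞`
if no such `a` exists. -/
def luxNorm {X : Type*} [MeasurableSpace X] (ν : Measure X) (χ : ℝ → ℝ)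
    (g : X → ℝ) : ℝ≥0∞ :=
  sInf {a : ℝ≥0∞ | ∃ b : ℝ, 0 < b ∧ a = ENNReal.ofReal b ∧
    ∫⁻ u, ENNReal.ofReal (χ (|g u| / b)) ∂ν ≤ 1}

/-- The Amemiya norm `‖g‖^μ_χ = inf_{a>0} a (1 + ∫ χ(|g|/a) dμ)`. -/
def amemiyaNorm {X : Type*} [MeasurableSpace X] (μ : Measure X) (χ : ℝ → ℝ)
    (g : X → ℝ) : ℝ≥0∞ :=
  sInf {c : ℝ≥0∞ | ∃ a : ℝ, 0 < a ∧
    c = ENNReal.ofReal a * (1 + ∫⁻ u, ENNReal.ofReal (χ (|g u| / a)) ∂μ)}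

/-- `r_0(x) = D(T)` and, for `k ≥ 1`,
`r_k(x) = min {ε ≥ 0 : 1 / m(B(x,ε)) ≤ φ(R^k)}` (with `1/0 = ∞`). -/
def rad {T : Type*} [MetricSpace T] [MeasurableSpace T]
    (m : Measure T) (φ : ℝ → ℝ) (R : ℝ) : ℕ → T → ℝ
  | 0, _ => Metric.diam (Set.univ : Set T)
  | k + 1, x => sInf {ε : ℝ | 0 ≤ ε ∧
      1 / m (Metric.closedBall x ε) ≤ ENNReal.ofReal (φ (R ^ (k + 1)))}

/-- `r^l_k(x) = ∑_{i=k}^{l} 2^(i-k) r_i(x)`. -/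
def radl {T : Type*} [MetricSpace T] [MeasurableSpace T]
    (m : Measure T) (φ : ℝ → ℝ) (R : ℝ) (k l : ℕ) (x : T) : ℝ :=
  ∑ i ∈ Finset.Icc k l, (2 : ℝ) ^ (i - k) * rad m φ R i x

/-- The averaging operator `S_k f (x) = (1 / m(B_k(x))) ∫_{B_k(x)} f dm`,
with the convention `0/0 = 0`. -/
def avg {T : Type*} [MetricSpace T] [MeasurableSpace T]
    (m : Measure T) (φ : ℝ → ℝ) (R : ℝ) (k : ℕ) (f : T → ℝ) (x : T) : ℝ :=
  (∫ u in Metric.closedBall x (rad m φ R k x), f u ∂m) /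
    (m (Metric.closedBall x (rad m φ R k x))).toReal

/-- The iterated averaging operator `iterAvg k l f = S_l S_{l-1} ⋯ S_k f` (for `k ≤ l`). -/
def iterAvg {T : Type*} [MetricSpace T] [MeasurableSpace T]
    (m : Measure T) (φ : ℝ → ℝ) (R : ℝ) (k : ℕ) : ℕ → (T → ℝ) → T → ℝ
  | 0, f => avg m φ R 0 f
  | l + 1, f =>
      if l + 1 ≤ k then avg m φ R (l + 1) f
      else avg m φ R (l + 1) (iterAvg m φ R k l f)

/-- The set `{k ≥ 1 : B^l_k(s) ∪ B^l_k(t) ⊆ B°(u, r_{k-1}(u)) for every u ∈ B^l_k(x)}`,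
whose greatest element is `τ_x`. -/
def tauSet {T : Type*} [MetricSpace T] [MeasurableSpace T]
    (m : Measure T) (φ : ℝ → ℝ) (R : ℝ) (l : ℕ) (s t x : T) : Set ℕ :=
  {k : ℕ | 1 ≤ k ∧ ∀ u ∈ Metric.closedBall x (radl m φ R k l x),
    Metric.closedBall s (radl m φ R k l s) ∪ Metric.closedBall t (radl m φ R k l t) ⊆
      Metric.ball u (rad m φ R (k - 1) u)}

open ProbabilityTheory Metric

section MassRadius

variable {T : Type*} [MetricSpace T] [MeasurableSpace T]

/-- The least radius `ε ≥ 0` such that `m (B(x,ε)) ≥ c`. -/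
def massRadius (m : Measure T) (c : ℝ≥0∞) (x : T) : ℝ :=
  sInf {ε : ℝ | 0 ≤ ε ∧ c ≤ m (closedBall x ε)}

lemma massRadius_nonneg (m : Measure T) (c : ℝ≥0∞) (x : T) : 0 ≤ massRadius m c x :=
  Real.sInf_nonneg fun _ h => h.1

lemma massRadius_le {m : Measure T} {c : ℝ≥0∞} {x : T} {ε : ℝ} (hε : 0 ≤ ε)
    (h : c ≤ m (closedBall x ε)) : massRadius m c x ≤ ε :=
  csInf_le ⟨0, fun _ h => h.1⟩ ⟨hε, h⟩

lemma measure_closedBall_lt_of_lt_massRadius {m : Measure T} {c : ℝ≥0∞} {x : T} {ε : ℝ}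
    (hε : 0 ≤ ε) (h : ε < massRadius m c x) : m (closedBall x ε) < c := by
  by_contra! hc
  exact absurd (massRadius_le hε hc) (not_le.2 h)

lemma measure_ball_massRadius_le (m : Measure T) (c : ℝ≥0∞) (x : T) :
    m (ball x (massRadius m c x)) ≤ c := by
  set ρ := massRadius m c x with hρ
  have hsub : ball x ρ ⊆ ⋃ n : ℕ, closedBall x (ρ - 1 / ((n : ℝ) + 1)) := by
    intro y hy
    obtain ⟨n, hn⟩ := exists_nat_one_div_lt (sub_pos.2 (mem_ball.1 hy))
    exact Set.mem_iUnion.2 ⟨n, mem_closedBall.2 (by linarith)⟩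
  have hmono : Monotone fun n : ℕ => closedBall x (ρ - 1 / ((n : ℝ) + 1)) := by
    intro i j hij
    refine closedBall_subset_closedBall ?_
    have := one_div_le_one_div_of_le (by positivity : (0 : ℝ) < (i : ℝ) + 1)
      (by exact_mod_cast Nat.succ_le_succ hij : (i : ℝ) + 1 ≤ (j : ℝ) + 1)
    linarith
  refine (measure_mono hsub).trans ?_
  rw [hmono.measure_iUnion]
  refine iSup_le fun n => ?_
  have hn : (0 : ℝ) < 1 / ((n : ℝ) + 1) := by positivity
  rcases lt_or_ge (ρ - 1 / ((n : ℝ) + 1)) 0 with h | h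
  · rw [closedBall_eq_empty.2 h, measure_empty]
    exact zero_le
  · exact (measure_closedBall_lt_of_lt_massRadius h (by linarith)).le

variable [CompactSpace T]

lemma measure_closedBall_diam (m : Measure T) [IsProbabilityMeasure m] (x : T) :
    m (closedBall x (diam (Set.univ : Set T))) = 1 := by
  have : closedBall x (diam (Set.univ : Set T)) = Set.univ :=
    Set.eq_univ_of_forall fun y =>
      mem_closedBall.2 (dist_le_diam_of_mem isCompact_univ.isBounded (Set.mem_univ _)
        (Set.mem_univ _))
  simp [this]

variable (m : Measure T) [IsProbabilityMeasure m] {c : ℝ≥0∞}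

lemma massRadius_set_nonempty (hc : c ≤ 1) (x : T) :
    {ε : ℝ | 0 ≤ ε ∧ c ≤ m (closedBall x ε)}.Nonempty :=
  ⟨_, diam_nonneg, by rwa [measure_closedBall_diam m x]⟩

variable [BorelSpace T]

lemma le_measure_closedBall_massRadius (hc : c ≤ 1) (x : T) :
    c ≤ m (closedBall x (massRadius m c x)) := by
  set ρ := massRadius m c x with hρ
  have heq : closedBall x ρ = ⋂ n : ℕ, closedBall x (ρ + 1 / ((n : ℝ) + 1)) := by
    ext y
    simp only [mem_closedBall, Set.mem_iInter]
    refine ⟨fun h n => h.trans (le_add_of_nonneg_right (by positivity)), fun h => ?_⟩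
    by_contra! hlt
    obtain ⟨n, hn⟩ := exists_nat_one_div_lt (sub_pos.2 hlt)
    linarith [h n]
  have hanti : Antitone fun n : ℕ => closedBall x (ρ + 1 / ((n : ℝ) + 1)) := by
    intro i j hij
    refine closedBall_subset_closedBall ?_
    have := one_div_le_one_div_of_le (by positivity : (0 : ℝ) < (i : ℝ) + 1)
      (by exact_mod_cast Nat.succ_le_succ hij : (i : ℝ) + 1 ≤ (j : ℝ) + 1)
    linarith
  rw [heq, hanti.measure_iInter
    (fun n => (isClosed_closedBall.measurableSet).nullMeasurableSet) ⟨0, measure_ne_top _ _⟩]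
  refine le_iInf fun n => ?_
  have hn : (0 : ℝ) < 1 / ((n : ℝ) + 1) := by positivity
  obtain ⟨ε, ⟨_, hε⟩, hlt⟩ := exists_lt_of_csInf_lt (massRadius_set_nonempty m hc x)
    (show massRadius m c x < ρ + 1 / ((n : ℝ) + 1) by linarith)
  exact hε.trans (measure_mono (closedBall_subset_closedBall hlt.le))

lemma massRadius_le_add_dist (hc : c ≤ 1) (x y : T) :
    massRadius m c x ≤ massRadius m c y + dist x y := by
  refine massRadius_le (add_nonneg (massRadius_nonneg _ _ _) dist_nonneg) ?_
  refine (le_measure_closedBall_massRadius m hc y).trans (measure_mono ?_)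
  exact closedBall_subset_closedBall' (by rw [dist_comm y x])

lemma continuous_massRadius (hc : c ≤ 1) : Continuous (massRadius m c) :=
  (LipschitzWith.of_le_add (massRadius_le_add_dist m hc)).continuous

open Classical in
/-- The density with respect to `m` of the uniform averages over the balls of mass about `c`. -/
def massDensity (m : Measure T) (c : ℝ≥0∞) (p : T × T) : ℝ≥0∞ :=
  if dist p.1 p.2 ≤ massRadius m c p.1 then
    (m (closedBall p.1 (massRadius m c p.1)))⁻¹ else 0

lemma measurableSet_dist_le_massRadius (hc : c ≤ 1) :
    MeasurableSet {p : T × T | dist p.1 p.2 ≤ massRadius m c p.1} :=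
  (isClosed_le continuous_dist ((continuous_massRadius m hc).comp continuous_fst)).measurableSet

lemma measurable_massDensity (hc : c ≤ 1) : Measurable (massDensity m c) := by
  classical
  refine Measurable.ite (measurableSet_dist_le_massRadius m hc) ?_ measurable_const
  have h := measurable_measure_prodMk_left (ν := m) (measurableSet_dist_le_massRadius m hc)
  have heq : (fun x => m (closedBall x (massRadius m c x))) =
      fun x => m (Prod.mk x ⁻¹' {p : T × T | dist p.1 p.2 ≤ massRadius m c p.1}) := by
    funext x
    congr 1
    ext y
    simp [dist_comm]
  rw [← heq] at h
  exact (h.comp measurable_fst).inv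

lemma massDensity_le (hc : c ≤ 1) (p : T × T) : massDensity m c p ≤ c⁻¹ := by
  unfold massDensity
  split_ifs
  · exact ENNReal.inv_le_inv.2 (le_measure_closedBall_massRadius m hc _)
  · exact zero_le

lemma lintegral_massDensity (hc : c ≤ 1) (hc0 : c ≠ 0) (x : T) :
    ∫⁻ u, massDensity m c (x, u) ∂m = 1 := by
  have h : (fun u => massDensity m c (x, u)) =
      (closedBall x (massRadius m c x)).indicator
        fun _ => (m (closedBall x (massRadius m c x)))⁻¹ := by
    funext u
    by_cases hu : dist u x ≤ massRadius m c x
    · simp [massDensity, Set.indicator, dist_comm x u, hu]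
    · simp [massDensity, Set.indicator, dist_comm x u, hu]
  rw [h, lintegral_indicator_const isClosed_closedBall.measurableSet]
  refine ENNReal.inv_mul_cancel ?_ (measure_ne_top _ _)
  exact ((pos_iff_ne_zero.2 hc0).trans_le (le_measure_closedBall_massRadius m hc x)).ne'

/-- The Markov kernel averaging over the balls `B(x, massRadius m c x)`. -/
def avgKernel (m : Measure T) [IsProbabilityMeasure m] (c : ℝ≥0∞) : Kernel T T :=
  Kernel.withDensity (Kernel.const T m) fun x u => massDensity m c (x, u)

lemma lintegral_avgKernel (hc : c ≤ 1) (x : T) {g : T → ℝ≥0∞} (hg : Measurable g) :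
    ∫⁻ u, g u ∂(avgKernel m c x) = ∫⁻ u, massDensity m c (x, u) * g u ∂m := by
  have h : Measurable (Function.uncurry fun (x u : T) => massDensity m c (x, u)) :=
    measurable_massDensity m hc
  rw [avgKernel, Kernel.lintegral_withDensity _ h _ hg, Kernel.const_apply]

lemma avgKernel_univ (hc : c ≤ 1) (hc0 : c ≠ 0) (x : T) : avgKernel m c x Set.univ = 1 := by
  have := lintegral_avgKernel m hc x (g := fun _ => 1) measurable_const
  simpa [lintegral_massDensity m hc hc0 x] using this

lemma lintegral_avgKernel_le (hc : c ≤ 1) (x : T) {g : T → ℝ≥0∞} (hg : Measurable g) :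
    ∫⁻ u, g u ∂(avgKernel m c x) ≤ c⁻¹ * ∫⁻ u, g u ∂m := by
  rw [lintegral_avgKernel m hc x hg, ← lintegral_const_mul _ hg]
  exact lintegral_mono fun u => mul_le_mul_left (massDensity_le m hc _) _

lemma ae_avgKernel_dist_le (hc : c ≤ 1) (x : T) :
    ∀ᵐ u ∂(avgKernel m c x), dist u x ≤ massRadius m c x := by
  have hs : MeasurableSet (closedBall x (massRadius m c x))ᶜ :=
    isClosed_closedBall.measurableSet.compl
  have h := lintegral_avgKernel m hc x (measurable_one.indicator hs : Measurable
    ((closedBall x (massRadius m c x))ᶜ.indicator (1 : T → ℝ≥0∞)))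
  rw [lintegral_indicator_one hs] at h
  have h0 : (fun u => massDensity m c (x, u) *
      (closedBall x (massRadius m c x))ᶜ.indicator (1 : T → ℝ≥0∞) u) = fun _ => 0 := by
    funext u
    by_cases hu : dist u x ≤ massRadius m c x
    · simp [hu]
    · simp [massDensity, dist_comm x u, hu]
  rw [h0, lintegral_zero] at h
  rw [ae_iff]
  convert h using 2
  ext u
  simp

end MassRadius

section Chaining

lemma sum_two_mul_pow_le {R : ℝ} (hR : 3 ≤ R) (k n : ℕ) :
    ∑ i ∈ Finset.range n, 2 * R ^ (k + i) ≤ R ^ (k + n) := by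
  have hR0 : 0 < R := by linarith
  induction n with
  | zero => simpa using (pow_pos hR0 _).le
  | succ n ih =>
    have hp := pow_pos hR0 (k + n)
    rw [Finset.sum_range_succ, ← add_assoc k n 1, pow_succ]
    nlinarith

variable {T : Type*} [MetricSpace T] [MeasurableSpace T] (m : Measure T) {c : ℕ → ℝ≥0∞}

/-- The sum of the radii at the levels `k`, …, `k + n - 1`, with geometric weights. -/
def tailRadius (c : ℕ → ℝ≥0∞) (k n : ℕ) (x : T) : ℝ :=
  ∑ i ∈ Finset.range n, 2 ^ i * massRadius m (c (k + i)) x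

lemma tailRadius_nonneg (k n : ℕ) (x : T) : 0 ≤ tailRadius m c k n x :=
  Finset.sum_nonneg fun _ _ => mul_nonneg (by positivity) (massRadius_nonneg _ _ _)

lemma tailRadius_succ' (k n : ℕ) (x : T) :
    tailRadius m c k (n + 1) x = massRadius m (c k) x + 2 * tailRadius m c (k + 1) n x := by
  rw [tailRadius, Finset.sum_range_succ', tailRadius, Finset.mul_sum, add_comm]
  congr 1
  · simp
  · exact Finset.sum_congr rfl fun i _ => by rw [pow_succ, add_right_comm, ← add_assoc]; ring

variable [CompactSpace T] [BorelSpace T] [IsProbabilityMeasure m]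

/-- The law obtained from `x` by averaging successively at the levels `k + n`, …, `k`. -/
def chainKernel (c : ℕ → ℝ≥0∞) (k : ℕ) : ℕ → Kernel T T
  | 0 => avgKernel m (c k)
  | n + 1 => chainKernel c k n ∘ₖ avgKernel m (c (k + n + 1))

lemma tailRadius_le (hc : ∀ k, c k ≤ 1) (k n : ℕ) (u x : T) :
    tailRadius m c k n u ≤ tailRadius m c k n x + (2 ^ n - 1) * dist u x := by
  induction n with
  | zero => simp [tailRadius]
  | succ n ih =>
    have h := massRadius_le_add_dist m (hc (k + n)) u x
    have h2 : (0 : ℝ) < 2 ^ n := by positivity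
    simp only [tailRadius, Finset.sum_range_succ] at ih ⊢
    have := mul_le_mul_of_nonneg_left h h2.le
    rw [pow_succ]
    linarith

lemma chainKernel_univ (hc : ∀ k, c k ≤ 1) (hc0 : ∀ k, c k ≠ 0) (k n : ℕ) (x : T) :
    chainKernel m c k n x Set.univ = 1 := by
  induction n generalizing x with
  | zero => exact avgKernel_univ m (hc k) (hc0 k) x
  | succ n ih =>
    rw [chainKernel, Kernel.comp_apply' _ _ _ MeasurableSet.univ]
    simp [ih, avgKernel_univ m (hc _) (hc0 _) x]

lemma lintegral_chainKernel_const (hc : ∀ k, c k ≤ 1) (hc0 : ∀ k, c k ≠ 0) (k n : ℕ) (x : T)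
    (b : ℝ≥0∞) : ∫⁻ _, b ∂(chainKernel m c k n x) = b := by
  rw [lintegral_const, chainKernel_univ m hc hc0, mul_one]

lemma lintegral_avgKernel_const {c : ℝ≥0∞} (hc : c ≤ 1) (hc0 : c ≠ 0) (x : T)
    (b : ℝ≥0∞) : ∫⁻ _, b ∂(avgKernel m c x) = b := by
  rw [lintegral_const, avgKernel_univ m hc hc0, mul_one]

lemma lintegral_chainKernel_le (hc : ∀ k, c k ≤ 1) (hc0 : ∀ k, c k ≠ 0) (k n : ℕ) (x : T)
    {g : T → ℝ≥0∞} (hg : Measurable g) :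
    ∫⁻ u, g u ∂(chainKernel m c k n x) ≤ (c k)⁻¹ * ∫⁻ u, g u ∂m := by
  induction n generalizing x with
  | zero => exact lintegral_avgKernel_le m (hc k) x hg
  | succ n ih =>
    rw [chainKernel, Kernel.lintegral_comp _ _ _ hg]
    refine (lintegral_mono fun u => ih u).trans ?_
    rw [lintegral_avgKernel_const m (hc _) (hc0 _)]

lemma ae_chainKernel_dist_le (hc : ∀ k, c k ≤ 1) (k n : ℕ) (x : T) :
    ∀ᵐ u ∂(chainKernel m c k n x), dist u x ≤ tailRadius m c k (n + 1) x := by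
  induction n generalizing x with
  | zero => simpa [tailRadius, chainKernel] using ae_avgKernel_dist_le m (hc k) x
  | succ n ih =>
    rw [chainKernel, Kernel.ae_comp_iff (p := fun u => dist u x ≤ tailRadius m c k (n + 1 + 1) x)
      (measurableSet_le (by fun_prop) measurable_const)]
    filter_upwards [ae_avgKernel_dist_le m (hc (k + n + 1)) x] with u hu
    filter_upwards [ih u] with v hv
    have h1 := tailRadius_le m hc k (n + 1) u x
    have h2 : tailRadius m c k (n + 1 + 1) x =
        tailRadius m c k (n + 1) x + 2 ^ (n + 1) * massRadius m (c (k + n + 1)) x := by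
      rw [tailRadius, Finset.sum_range_succ, ← tailRadius, add_assoc]
    have h3 := mul_le_mul_of_nonneg_left hu (by positivity : (0 : ℝ) ≤ 2 ^ (n + 1))
    linarith [dist_triangle v u x]

lemma lintegral_avgKernel_le_chainKernel (hc : ∀ k, c k ≤ 1) (hc0 : ∀ k, c k ≠ 0)
    {R M : ℝ} (hR : 3 ≤ R) (hM : 0 ≤ M) {F : T × T → ℝ≥0∞} (hF : Measurable F)
    (hstep : ∀ j x, ∫⁻ u, ∫⁻ v, F (u, v) ∂(avgKernel m (c j) u) ∂(avgKernel m (c (j + 1)) x) ≤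
      ENNReal.ofReal
        ((massRadius m (c j) x + massRadius m (c (j + 1)) x) * (M * R ^ (j + 1))))
    {g : T → ℝ≥0∞} (hg : Measurable g) (hgF : ∀ u v, g u ≤ g v + F (u, v)) (k n : ℕ) (x : T) :
    ∫⁻ u, g u ∂(avgKernel m (c (k + n)) x) ≤ ∫⁻ u, g u ∂(chainKernel m c k n x) +
      ENNReal.ofReal (M * R * (∑ i ∈ Finset.range n, 2 * R ^ (k + i) * massRadius m (c (k + i)) x
        + R ^ (k + n) * massRadius m (c (k + n)) x)) := by
  have hR0 : 0 < R := by linarith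
  have hMR : 0 ≤ M * R := mul_nonneg hM hR0.le
  induction n generalizing x with
  | zero => exact le_self_add
  | succ n ih =>
    set r : ℕ → T → ℝ := fun j y => massRadius m (c j) y with hr
    set E : T → ℝ := fun y => M * R * (∑ i ∈ Finset.range n, 2 * R ^ (k + i) * r (k + i) y
        + R ^ (k + n) * r (k + n) y) with hE
    have hlip : ∀ j u, r j u ≤ r j x + dist u x := fun j u => massRadius_le_add_dist m (hc j) u x
    have hEu : ∀ᵐ u ∂(avgKernel m (c (k + n + 1)) x),
        E u ≤ E x + M * R * (2 * R ^ (k + n)) * r (k + n + 1) x := by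
      filter_upwards [ae_avgKernel_dist_le m (hc (k + n + 1)) x] with u hu
      have h1 : ∑ i ∈ Finset.range n, 2 * R ^ (k + i) * r (k + i) u ≤
          ∑ i ∈ Finset.range n, 2 * R ^ (k + i) * r (k + i) x + R ^ (k + n) * dist u x := by
        refine (Finset.sum_le_sum fun i _ => mul_le_mul_of_nonneg_left (hlip (k + i) u)
          (by positivity)).trans ?_
        simp only [mul_add, Finset.sum_add_distrib]
        rw [← Finset.sum_mul]
        gcongr
        exact sum_two_mul_pow_le hR k n
      have h2 := mul_le_mul_of_nonneg_left (hlip (k + n) u) (pow_pos hR0 (k + n)).le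
      have h3 := mul_le_mul_of_nonneg_left hu (pow_pos hR0 (k + n)).le
      calc E u ≤ M * R * ((∑ i ∈ Finset.range n, 2 * R ^ (k + i) * r (k + i) x
            + R ^ (k + n) * r (k + n) x) + 2 * R ^ (k + n) * r (k + n + 1) x) := by
            refine mul_le_mul_of_nonneg_left ?_ hMR
            linarith
        _ = _ := by simp only [hE]; ring
    have hFv : ∀ u, Measurable fun v => F (u, v) := fun u => hF.comp measurable_prodMk_left
    have : IsMarkovKernel (avgKernel m (c (k + n))) :=
      ⟨fun u => ⟨avgKernel_univ m (hc _) (hc0 _) u⟩⟩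
    have hD : Measurable fun u => ∫⁻ v, F (u, v) ∂(avgKernel m (c (k + n)) u) :=
      hF.lintegral_kernel_prod_right'
    have hC : Measurable fun u => ∫⁻ v, g v ∂(chainKernel m c k n u) :=
      hg.lintegral_kernel
    have hpt : ∀ u, g u ≤ (∫⁻ v, g v ∂(chainKernel m c k n u) + ENNReal.ofReal (E u)) +
        ∫⁻ v, F (u, v) ∂(avgKernel m (c (k + n)) u) := by
      intro u
      calc g u = ∫⁻ _, g u ∂(avgKernel m (c (k + n)) u) :=
            (lintegral_avgKernel_const m (hc _) (hc0 _) u _).symm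
        _ ≤ ∫⁻ v, (g v + F (u, v)) ∂(avgKernel m (c (k + n)) u) :=
            lintegral_mono fun v => hgF u v
        _ = _ := lintegral_add_left hg _
        _ ≤ _ := by gcongr; exact ih u
    have hr0 : ∀ j, 0 ≤ r j x := fun j => massRadius_nonneg _ _ _
    have hE0 : 0 ≤ E x := by
      refine mul_nonneg hMR (add_nonneg (Finset.sum_nonneg fun i _ => ?_) ?_)
      · exact mul_nonneg (by positivity) (hr0 _)
      · exact mul_nonneg (by positivity) (hr0 _)
    calc ∫⁻ u, g u ∂(avgKernel m (c (k + n + 1)) x)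
        ≤ ∫⁻ u, ((∫⁻ v, g v ∂(chainKernel m c k n u) +
            ENNReal.ofReal (E x + M * R * (2 * R ^ (k + n)) * r (k + n + 1) x)) +
            ∫⁻ v, F (u, v) ∂(avgKernel m (c (k + n)) u)) ∂(avgKernel m (c (k + n + 1)) x) := by
          refine lintegral_mono_ae ?_
          filter_upwards [hEu] with u hu
          exact (hpt u).trans (by gcongr)
      _ = (∫⁻ u, g u ∂(chainKernel m c k (n + 1) x) +
            ENNReal.ofReal (E x + M * R * (2 * R ^ (k + n)) * r (k + n + 1) x)) +
            ∫⁻ u, ∫⁻ v, F (u, v) ∂(avgKernel m (c (k + n)) u)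
              ∂(avgKernel m (c (k + n + 1)) x) := by
          rw [lintegral_add_right _ hD, lintegral_add_right _ measurable_const,
            lintegral_avgKernel_const m (hc _) (hc0 _), chainKernel,
            Kernel.lintegral_comp _ _ _ hg]
      _ ≤ (∫⁻ u, g u ∂(chainKernel m c k (n + 1) x) +
            ENNReal.ofReal (E x + M * R * (2 * R ^ (k + n)) * r (k + n + 1) x)) +
            ENNReal.ofReal ((r (k + n) x + r (k + n + 1) x) * (M * R ^ (k + n + 1))) := by
          gcongr
          exact hstep (k + n) x
      _ ≤ _ := by
          rw [add_assoc, ← ENNReal.ofReal_add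
            (add_nonneg hE0 (mul_nonneg (by positivity) (hr0 _)))
            (mul_nonneg (add_nonneg (hr0 _) (hr0 _)) (by positivity))]
          refine add_le_add le_rfl (ENNReal.ofReal_le_ofReal ?_)
          rw [Finset.sum_range_succ, ← add_assoc k n 1]
          have h4 : 0 ≤ M * R * R ^ (k + n) * r (k + n + 1) x * (R - 3) :=
            mul_nonneg (mul_nonneg (by positivity) (hr0 _)) (by linarith)
          have h5 : R ^ (k + n + 1) = R ^ (k + n) * R := pow_succ _ _
          simp only [hE, h5]
          linarith

end Chaining

section Oscillation

lemma lintegral_mul_one_add_mul {α : Type*} [MeasurableSpace α] {μ : Measure α}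
    (hμ : μ Set.univ = 1) (a q : ℝ≥0∞)
    {g : α → ℝ≥0∞} (hg : Measurable g) :
    ∫⁻ u, a * (1 + q * g u) ∂μ = a * (1 + q * ∫⁻ u, g u ∂μ) := by
  rw [lintegral_const_mul _ (by fun_prop), lintegral_add_left measurable_const,
    lintegral_const_mul _ hg, lintegral_const, hμ, mul_one]

variable {T : Type*} [MetricSpace T] [MeasurableSpace T] (m : Measure T) {c : ℕ → ℝ≥0∞}

open Classical in
/-- Weights on `T × T` of total mass at most one which do not charge, for `k ≥ 1`,
the pairs at distance at least `massRadius m (c (k - 1))`. -/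
def pairWeight (c : ℕ → ℝ≥0∞) : ℕ → T × T → ℝ≥0∞
  | 0, _ => 1
  | k + 1, p => if dist p.1 p.2 < massRadius m (c k) p.1 then (c k)⁻¹ else 0

variable [CompactSpace T] [BorelSpace T] [IsProbabilityMeasure m]

lemma measurable_pairWeight (hc : ∀ k, c k ≤ 1) (k : ℕ) : Measurable (pairWeight m c k) := by
  classical
  cases k with
  | zero => exact measurable_const
  | succ k =>
    refine Measurable.ite ?_ measurable_const measurable_const
    exact (isOpen_lt continuous_dist
      ((continuous_massRadius m (hc k)).comp continuous_fst)).measurableSet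

lemma lintegral_pairWeight_le (hc : ∀ k, c k ≤ 1) (k : ℕ) :
    ∫⁻ p, pairWeight m c k p ∂(m.prod m) ≤ 1 := by
  rw [lintegral_prod _ (measurable_pairWeight m hc k).aemeasurable]
  refine (lintegral_mono (g := fun _ => 1) fun x => ?_).trans (by simp)
  cases k with
  | zero => simp [pairWeight]
  | succ k =>
    have h : (fun y => pairWeight m c (k + 1) (x, y)) =
        (ball x (massRadius m (c k) x)).indicator fun _ => (c k)⁻¹ := by
      funext y
      by_cases hy : dist x y < massRadius m (c k) x
      · simp [pairWeight, Set.indicator, dist_comm y x, hy]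
      · simp [pairWeight, Set.indicator, dist_comm y x, hy]
    simp only
    rw [h, lintegral_indicator_const isOpen_ball.measurableSet]
    exact (mul_le_mul_right (measure_ball_massRadius_le m (c k) x) _).trans
      (ENNReal.inv_mul_le_one _)

lemma lintegral_massDensity_prod {c : ℝ≥0∞} (hc : c ≤ 1) (hc0 : c ≠ 0) :
    ∫⁻ p, massDensity m c p ∂(m.prod m) = 1 := by
  rw [lintegral_prod _ (measurable_massDensity m hc).aemeasurable]
  simp [lintegral_massDensity m hc hc0]

lemma lintegral_lintegral_avgKernel_le {c c' : ℝ≥0∞} (hc : c ≤ 1) (hc0 : c ≠ 0) (hc' : c' ≤ 1)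
    (hc0' : c' ≠ 0) {F H : T × T → ℝ≥0∞} (hH : Measurable H) {L A : ℝ} (hL : 0 ≤ L) {q : ℝ≥0∞}
    (hFH : ∀ p, F p ≤ ENNReal.ofReal (dist p.1 p.2 * L) * (1 + q * H p))
    (hA : q * (c'⁻¹ * ∫⁻ p, massDensity m c p * H p ∂(m.prod m)) ≤ ENNReal.ofReal A) (x : T) :
    ∫⁻ u, ∫⁻ v, F (u, v) ∂(avgKernel m c u) ∂(avgKernel m c' x) ≤
      ENNReal.ofReal ((massRadius m c x + massRadius m c' x) * L) * (1 + ENNReal.ofReal A) := by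
  have hmd : Measurable fun p => massDensity m c p * H p := (measurable_massDensity m hc).mul hH
  have hI : Measurable fun u => ∫⁻ v, massDensity m c (u, v) * H (u, v) ∂m :=
    hmd.lintegral_prod_right'
  have h1 : ∀ᵐ u ∂(avgKernel m c' x), ∫⁻ v, F (u, v) ∂(avgKernel m c u) ≤
      ENNReal.ofReal ((massRadius m c x + massRadius m c' x) * L) *
        (1 + q * ∫⁻ v, massDensity m c (u, v) * H (u, v) ∂m) := by
    filter_upwards [ae_avgKernel_dist_le m hc' x] with u hu
    have hHu : Measurable fun v => H (u, v) := hH.comp measurable_prodMk_left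
    calc ∫⁻ v, F (u, v) ∂(avgKernel m c u)
        ≤ ∫⁻ v, ENNReal.ofReal ((massRadius m c x + massRadius m c' x) * L) * (1 + q * H (u, v))
            ∂(avgKernel m c u) := by
          refine lintegral_mono_ae ?_
          filter_upwards [ae_avgKernel_dist_le m hc u] with v hv
          refine (hFH (u, v)).trans ?_
          gcongr
          have := massRadius_le_add_dist m hc u x
          simp only
          rw [dist_comm u v]
          linarith
      _ = _ := by
          rw [lintegral_mul_one_add_mul (avgKernel_univ m hc hc0 u) _ _ hHu,
            lintegral_avgKernel m hc u hHu]
  refine (lintegral_mono_ae h1).trans ?_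
  rw [lintegral_mul_one_add_mul (avgKernel_univ m hc' hc0' x) _ _ hI]
  gcongr
  refine le_trans ?_ hA
  gcongr
  rw [lintegral_prod _ hmd.aemeasurable]
  exact lintegral_avgKernel_le m hc' x hI

lemma lintegral_chainKernel_pair_le (hc : ∀ k, c k ≤ 1) (hc0 : ∀ k, c k ≠ 0) (hc1 : c 0 = 1)
    (hconv : ∀ k, (c (k + 1))⁻¹ * (c (k + 1))⁻¹ ≤ (c (k + 2))⁻¹ * (c k)⁻¹)
    {F H : T × T → ℝ≥0∞} (hH : Measurable H) {L A : ℝ} (hL : 0 ≤ L) {q : ℝ≥0∞}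
    (hFH : ∀ p, F p ≤ ENNReal.ofReal (dist p.1 p.2 * L) * (1 + q * H p)) (k n : ℕ)
    (hA : q * ((c (k + 1))⁻¹ * ∫⁻ p, pairWeight m c k p * H p ∂(m.prod m)) ≤ ENNReal.ofReal A)
    (s t : T)
    (hk : ∀ j, k = j + 1 → dist s t + 2 * tailRadius m c k (n + 1) s + tailRadius m c k (n + 1) t
      < massRadius m (c j) s) :
    ∫⁻ u, ∫⁻ v, F (u, v) ∂(chainKernel m c k n t) ∂(chainKernel m c k n s) ≤
      ENNReal.ofReal ((dist s t + tailRadius m c k (n + 1) s + tailRadius m c k (n + 1) t) * L) *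
        (1 + ENNReal.ofReal A) := by
  set ρs := tailRadius m c k (n + 1) s with hρs
  set ρt := tailRadius m c k (n + 1) t with hρt
  set S : Set (T × T) := {p | dist p.1 s ≤ ρs ∧ dist p.2 t ≤ ρt} with hS
  have hSm : MeasurableSet S :=
    (measurableSet_le (measurable_fst.dist measurable_const) measurable_const).inter
      (measurableSet_le (measurable_snd.dist measurable_const) measurable_const)
  have hdist : ∀ p ∈ S, dist p.1 p.2 ≤ dist s t + ρs + ρt := by
    rintro ⟨u, v⟩ ⟨hu, hv⟩
    simp only at hu hv ⊢
    linarith [dist_triangle4 u s t v, dist_comm t v]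
  set H' := S.indicator H with hH'
  have hH'm : Measurable H' := hH.indicator hSm
  have hI : Measurable fun u => ∫⁻ v, H' (u, v) ∂m := hH'm.lintegral_prod_right'
  have h1 : ∀ᵐ u ∂(chainKernel m c k n s), ∫⁻ v, F (u, v) ∂(chainKernel m c k n t) ≤
      ENNReal.ofReal ((dist s t + ρs + ρt) * L) *
        (1 + q * ((c k)⁻¹ * ∫⁻ v, H' (u, v) ∂m)) := by
    filter_upwards [ae_chainKernel_dist_le m hc k n s] with u hu
    have hHu : Measurable fun v => H' (u, v) := hH'm.comp measurable_prodMk_left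
    calc ∫⁻ v, F (u, v) ∂(chainKernel m c k n t)
        ≤ ∫⁻ v, ENNReal.ofReal ((dist s t + ρs + ρt) * L) * (1 + q * H' (u, v))
            ∂(chainKernel m c k n t) := by
          refine lintegral_mono_ae ?_
          filter_upwards [ae_chainKernel_dist_le m hc k n t] with v hv
          have hmem : (u, v) ∈ S := ⟨hu, hv⟩
          refine (hFH (u, v)).trans ?_
          rw [hH', Set.indicator_of_mem hmem]
          gcongr
          exact hdist _ hmem
      _ ≤ _ := by
          rw [lintegral_mul_one_add_mul (chainKernel_univ m hc hc0 k n t) _ _ hHu]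
          gcongr
          exact lintegral_chainKernel_le m hc hc0 k n t hHu
  refine (lintegral_mono_ae h1).trans ?_
  rw [lintegral_mul_one_add_mul (chainKernel_univ m hc hc0 k n s) _ _ (hI.const_mul _),
    lintegral_const_mul _ hI]
  gcongr
  refine le_trans (mul_le_mul_right ?_ q) hA
  calc (c k)⁻¹ * ∫⁻ u, ∫⁻ v, H' (u, v) ∂m ∂(chainKernel m c k n s)
      ≤ (c k)⁻¹ * ((c k)⁻¹ * ∫⁻ u, ∫⁻ v, H' (u, v) ∂m ∂m) := by
        gcongr
        exact lintegral_chainKernel_le m hc hc0 k n s hI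
    _ = ∫⁻ p, (c k)⁻¹ * (c k)⁻¹ * H' p ∂(m.prod m) := by
        rw [lintegral_const_mul _ hH'm, lintegral_prod _ hH'm.aemeasurable, mul_assoc]
    _ ≤ ∫⁻ p, (c (k + 1))⁻¹ * (pairWeight m c k p * H p) ∂(m.prod m) := by
        refine lintegral_mono fun p => ?_
        by_cases hp : p ∈ S
        · simp only [hH', Set.indicator_of_mem hp]
          rw [← mul_assoc]
          refine mul_le_mul_left ?_ _
          cases k with
          | zero =>
            simpa [hc1, pairWeight] using hc 1
          | succ j =>
            have hlt : dist p.1 p.2 < massRadius m (c j) p.1 := by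
              have h2 := hk j rfl
              have h3 := massRadius_le_add_dist m (hc j) s p.1
              have h4 := hdist p hp
              have h5 := hp.1
              rw [dist_comm] at h5
              linarith
            simpa [pairWeight, hlt] using hconv j
        · simp [hH', hp]
    _ = _ := lintegral_const_mul _ ((measurable_pairWeight m hc k).mul hH)

end Oscillation

lemma sum_pow_mul_le_of_le_add_tail {R : ℝ} (hR : 10 ≤ R) {n : ℕ} {z b P : ℕ → ℝ}
    (hP : ∀ i ≤ n, P i = z i + 2 * P (i + 1)) (hPn : P (n + 1) = 0) (hP0 : ∀ i, 0 ≤ P i)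
    (hz : ∀ i ≤ n, z i ≤ 2 * b i + 4 * P (i + 1)) :
    ∑ i ∈ Finset.range (n + 1), R ^ i * z i ≤ 4 * ∑ i ∈ Finset.range (n + 1), R ^ i * b i ∧
      P 0 ≤ ∑ i ∈ Finset.range (n + 1), R ^ i * z i := by
  have hR0 : 0 < R := by linarith
  have key : ∀ j ≤ n + 1, 8 * ∑ i ∈ Finset.Ico j (n + 1), R ^ i * P (i + 1) + R ^ j * P j ≤
      ∑ i ∈ Finset.Ico j (n + 1), R ^ i * z i := by
    intro j hj
    induction hj using Nat.decreasingInduction with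
    | self => simp [hPn]
    | of_succ j hj ih =>
      rw [Finset.sum_eq_sum_Ico_succ_bot hj, Finset.sum_eq_sum_Ico_succ_bot hj,
        hP j (Nat.lt_succ_iff.1 hj)]
      have h1 : 0 ≤ R ^ j * P (j + 1) * (R - 10) :=
        mul_nonneg (mul_nonneg (by positivity) (hP0 _)) (by linarith)
      rw [pow_succ] at ih
      linarith
  have h0 := key 0 (Nat.zero_le _)
  rw [← Finset.range_eq_Ico] at h0
  have hU : 0 ≤ ∑ i ∈ Finset.range (n + 1), R ^ i * P (i + 1) :=
    Finset.sum_nonneg fun i _ => mul_nonneg (by positivity) (hP0 _)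
  have hZ : ∑ i ∈ Finset.range (n + 1), R ^ i * z i ≤
      2 * ∑ i ∈ Finset.range (n + 1), R ^ i * b i +
        4 * ∑ i ∈ Finset.range (n + 1), R ^ i * P (i + 1) := by
    rw [Finset.mul_sum, Finset.mul_sum, ← Finset.sum_add_distrib]
    refine Finset.sum_le_sum fun i hi => ?_
    have := mul_le_mul_of_nonneg_left (hz i (Nat.lt_succ_iff.1 (Finset.mem_range.1 hi)))
      (pow_pos hR0 i).le
    linarith
  have := hP0 0
  simp only [pow_zero, one_mul] at h0
  constructor <;> linarith

section Deterministic

variable {T : Type*} [MetricSpace T] [MeasurableSpace T] (m : Measure T) {c : ℕ → ℝ≥0∞}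

lemma exists_coarsest_scale (c : ℕ → ℝ≥0∞) (l : ℕ) (s t : T) :
    ∃ k n, k + n = l ∧
      (∀ j, k = j + 1 → dist s t + 2 * tailRadius m c k (n + 1) s + tailRadius m c k (n + 1) t
        < massRadius m (c j) s) ∧
      ∀ i < n, massRadius m (c (k + i)) s ≤ dist s t +
        2 * tailRadius m c (k + (i + 1)) (n - i) s + tailRadius m c (k + (i + 1)) (n - i) t := by
  suffices h : ∀ k n, k + n = l → (∀ i < n, massRadius m (c (k + i)) s ≤ dist s t +
      2 * tailRadius m c (k + (i + 1)) (n - i) s + tailRadius m c (k + (i + 1)) (n - i) t) → _ from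
    h l 0 (by simp) (by simp)
  intro k
  induction k with
  | zero => exact fun n hn h => ⟨0, n, hn, by simp, h⟩
  | succ k ih =>
    intro n hn h
    by_cases hk : dist s t + 2 * tailRadius m c (k + 1) (n + 1) s +
        tailRadius m c (k + 1) (n + 1) t < massRadius m (c k) s
    · exact ⟨k + 1, n, hn, fun j hj => by rwa [← Nat.succ_injective hj], h⟩
    · refine ih (n + 1) (by omega) fun i hi => ?_
      cases i with
      | zero => simpa using not_lt.1 hk
      | succ i =>
        have := h i (by omega)
        rwa [Nat.add_sub_add_right, show k + (i + 1) = k + 1 + i by ring,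
          show k + (i + 1 + 1) = k + 1 + (i + 1) by ring]

variable [CompactSpace T] [BorelSpace T] [IsProbabilityMeasure m]

lemma abs_sub_le_of_lintegral_pair_le (hc : ∀ k, c k ≤ 1) (hc0 : ∀ k, c k ≠ 0)
    {R M : ℝ} (hR : 3 ≤ R) (hM : 0 ≤ M) {f : T → ℝ} (hf : Continuous f)
    (hstep : ∀ j x, ∫⁻ u, ∫⁻ v, ENNReal.ofReal |f u - f v|
        ∂(avgKernel m (c j) u) ∂(avgKernel m (c (j + 1)) x) ≤
      ENNReal.ofReal
        ((massRadius m (c j) x + massRadius m (c (j + 1)) x) * (M * R ^ (j + 1))))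
    (k n : ℕ) (s t : T) {δ η : ℝ} (hδ : 0 ≤ δ) (hη : 0 ≤ η)
    (hs : ∀ u, dist u s ≤ massRadius m (c (k + n)) s → |f u - f s| ≤ η)
    (ht : ∀ u, dist u t ≤ massRadius m (c (k + n)) t → |f u - f t| ≤ η)
    (hpair : ∫⁻ u, ∫⁻ v, ENNReal.ofReal |f u - f v|
      ∂(chainKernel m c k n t) ∂(chainKernel m c k n s) ≤ ENNReal.ofReal (δ * (M * R ^ (k + 1)))) :
    |f s - f t| ≤ M * R ^ (k + 1) * (δ + 2 * ∑ i ∈ Finset.range (n + 1),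
      R ^ i * (massRadius m (c (k + i)) s + massRadius m (c (k + i)) t)) + 2 * η := by
  have hR0 : 0 < R := by linarith
  set E : T → ℝ := fun x => M * R * (∑ i ∈ Finset.range n,
    2 * R ^ (k + i) * massRadius m (c (k + i)) x + R ^ (k + n) * massRadius m (c (k + n)) x)
    with hE
  have hr0 : ∀ j x, 0 ≤ massRadius m (c j) x := fun _ _ => massRadius_nonneg _ _ _
  have hE0 : ∀ x, 0 ≤ E x := fun x => by
    refine mul_nonneg (by positivity) (add_nonneg (Finset.sum_nonneg fun i _ => ?_) ?_)
    · exact mul_nonneg (by positivity) (hr0 _ _)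
    · exact mul_nonneg (by positivity) (hr0 _ _)
  have hEle : ∀ x, E x ≤ M * R ^ (k + 1) *
      (2 * ∑ i ∈ Finset.range (n + 1), R ^ i * massRadius m (c (k + i)) x) := by
    intro x
    have h1 : 0 ≤ R ^ n * massRadius m (c (k + n)) x := mul_nonneg (by positivity) (hr0 _ _)
    have h2 : E x = M * R ^ (k + 1) * (2 * ∑ i ∈ Finset.range n,
        R ^ i * massRadius m (c (k + i)) x + R ^ n * massRadius m (c (k + n)) x) := by
      simp only [hE, Finset.mul_sum, mul_add, pow_add]
      congr 1
      · exact Finset.sum_congr rfl fun i _ => by ring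
      · ring
    rw [h2, Finset.sum_range_succ]
    gcongr
    linarith
  set F : T × T → ℝ≥0∞ := fun p => ENNReal.ofReal |f p.1 - f p.2| with hF
  have hFm : Measurable F := by
    have : Measurable f := hf.measurable
    fun_prop
  have hFtri : ∀ x u v, F (u, x) ≤ F (v, x) + F (u, v) := by
    intro x u v
    simp only [hF]
    rw [← ENNReal.ofReal_add (abs_nonneg _) (abs_nonneg _)]
    refine ENNReal.ofReal_le_ofReal ?_
    rw [add_comm]
    exact abs_sub_le _ _ _
  have hlimit : ∀ x y : T,
      (∀ u, dist u x ≤ massRadius m (c (k + n)) x → |f u - f x| ≤ η) →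
      F (x, y) ≤ ENNReal.ofReal η +
        (∫⁻ u, F (u, y) ∂(chainKernel m c k n x) + ENNReal.ofReal (E x)) := by
    intro x y hx
    have hFy : Measurable fun u => F (u, y) := hFm.comp measurable_prodMk_right
    calc F (x, y) = ∫⁻ _, F (x, y) ∂(avgKernel m (c (k + n)) x) :=
          (lintegral_avgKernel_const m (hc _) (hc0 _) _ _).symm
      _ ≤ ∫⁻ u, (ENNReal.ofReal η + F (u, y)) ∂(avgKernel m (c (k + n)) x) := by
          refine lintegral_mono_ae ?_
          filter_upwards [ae_avgKernel_dist_le m (hc (k + n)) x] with u hu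
          refine (hFtri y x u).trans ?_
          rw [add_comm]
          gcongr
          refine ENNReal.ofReal_le_ofReal ?_
          simp only
          rw [abs_sub_comm]
          exact hx u hu
      _ = ENNReal.ofReal η + ∫⁻ u, F (u, y) ∂(avgKernel m (c (k + n)) x) := by
          rw [lintegral_add_left measurable_const, lintegral_avgKernel_const m (hc _) (hc0 _)]
      _ ≤ _ := by
          gcongr
          exact lintegral_avgKernel_le_chainKernel m hc hc0 hR hM hFm hstep hFy
            (fun u v => hFtri y u v) k n x
  have hsymm : ∀ u v, F (u, v) = F (v, u) := fun u v => by simp only [hF, abs_sub_comm]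
  have htot : F (s, t) ≤ ENNReal.ofReal η + ((ENNReal.ofReal (δ * (M * R ^ (k + 1))) +
      (ENNReal.ofReal η + ENNReal.ofReal (E t))) + ENNReal.ofReal (E s)) := by
    refine (hlimit s t hs).trans ?_
    gcongr
    calc ∫⁻ u, F (u, t) ∂(chainKernel m c k n s)
        ≤ ∫⁻ u, (∫⁻ v, F (u, v) ∂(chainKernel m c k n t) +
            (ENNReal.ofReal η + ENNReal.ofReal (E t))) ∂(chainKernel m c k n s) := by
          refine lintegral_mono fun u => ?_
          have h := hlimit t u ht
          simp only [hsymm _ u] at h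
          refine h.trans (le_of_eq ?_)
          ring
      _ = ∫⁻ u, ∫⁻ v, F (u, v) ∂(chainKernel m c k n t) ∂(chainKernel m c k n s) +
            (ENNReal.ofReal η + ENNReal.ofReal (E t)) := by
          rw [lintegral_add_right _ measurable_const, lintegral_chainKernel_const m hc hc0]
      _ ≤ _ := by gcongr
  have hδ' : 0 ≤ δ * (M * R ^ (k + 1)) := by positivity
  rw [← ENNReal.ofReal_add hη (hE0 t), ← ENNReal.ofReal_add hδ' (add_nonneg hη (hE0 t)),
    ← ENNReal.ofReal_add (add_nonneg hδ' (add_nonneg hη (hE0 t))) (hE0 s),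
    ← ENNReal.ofReal_add hη (add_nonneg (add_nonneg hδ' (add_nonneg hη (hE0 t))) (hE0 s)),
    ENNReal.ofReal_le_ofReal_iff
      (add_nonneg hη (add_nonneg (add_nonneg hδ' (add_nonneg hη (hE0 t))) (hE0 s)))] at htot
  have h1 := hEle s
  have h2 := hEle t
  simp only [mul_add, Finset.sum_add_distrib] at htot h1 h2 ⊢
  linarith

lemma abs_sub_le_of_sum_min_le (hc : ∀ k, c k ≤ 1) (hc0 : ∀ k, c k ≠ 0) (hc1 : c 0 = 1)
    (hconv : ∀ k, (c (k + 1))⁻¹ * (c (k + 1))⁻¹ ≤ (c (k + 2))⁻¹ * (c k)⁻¹)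
    {R Λ A : ℝ} (hR : 10 ≤ R) (hΛ : 0 ≤ Λ) (hA0 : 0 ≤ A) {f : T → ℝ} (hf : Continuous f)
    {H : T × T → ℝ≥0∞} (hH : Measurable H) {q : ℕ → ℝ≥0∞}
    (hFH : ∀ k p, ENNReal.ofReal |f p.1 - f p.2| ≤
      ENNReal.ofReal (dist p.1 p.2 * (R ^ k * Λ)) * (1 + q k * H p))
    (hA : ∀ k, q (k + 1) * ((c (k + 1))⁻¹ * ∫⁻ p, massDensity m (c k) p * H p ∂(m.prod m)) ≤
      ENNReal.ofReal A)
    (hB : ∀ k, q (k + 1) * ((c (k + 1))⁻¹ * ∫⁻ p, pairWeight m c k p * H p ∂(m.prod m)) ≤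
      ENNReal.ofReal A)
    {s t : T} (hst : s ≠ t) {τ : ℝ} (hdτ : dist s t ≤ τ)
    (hs : ∀ n, ∑ i ∈ Finset.range n, R ^ i * min (massRadius m (c i) s) (dist s t) ≤ 2 * τ)
    (ht : ∀ n, ∑ i ∈ Finset.range n, R ^ i * min (massRadius m (c i) t) (dist s t) ≤ 2 * τ) :
    |f s - f t| ≤ (48 + 2 * R) * R * Λ * (1 + A) * τ := by
  have hR0 : 0 < R := by linarith
  have hd : 0 < dist s t := dist_pos.2 hst
  have hτ : 0 < τ := hd.trans_le hdτ
  have hr0 : ∀ j x, 0 ≤ massRadius m (c j) x := fun _ _ => massRadius_nonneg _ _ _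
  have hmin0 : ∀ j x, 0 ≤ R ^ j * min (massRadius m (c j) x) (dist s t) := fun j x =>
    mul_nonneg (by positivity) (le_min (hr0 _ _) hd.le)
  have hterm : ∀ x, (∀ n, ∑ i ∈ Finset.range n,
      R ^ i * min (massRadius m (c i) x) (dist s t) ≤ 2 * τ) →
      ∀ j, R ^ j * min (massRadius m (c j) x) (dist s t) ≤ 2 * τ := fun x hx j =>
    (Finset.single_le_sum (f := fun i => R ^ i * min (massRadius m (c i) x) (dist s t))
      (fun i _ => hmin0 i x) (Finset.self_mem_range_succ j)).trans (hx (j + 1))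
  have hfine : ∀ x, (∀ n, ∑ i ∈ Finset.range n,
      R ^ i * min (massRadius m (c i) x) (dist s t) ≤ 2 * τ) → ∀ ε > 0,
      ∀ᶠ l in atTop, massRadius m (c l) x < ε := by
    intro x hx ε hε
    have hpow : Tendsto (fun l : ℕ => R ^ l * min ε (dist s t)) atTop atTop :=
      (tendsto_pow_atTop_atTop_of_one_lt (by linarith)).atTop_mul_const (lt_min hε hd)
    filter_upwards [hpow.eventually_gt_atTop (2 * τ)] with l hl
    by_contra! h
    exact absurd (hterm x hx l) (not_le.2 (hl.trans_le (by gcongr)))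
  set M := Λ * (1 + A) with hM
  have hM0 : 0 ≤ M := by positivity
  have hstep : ∀ j x, ∫⁻ u, ∫⁻ v, ENNReal.ofReal |f u - f v|
        ∂(avgKernel m (c j) u) ∂(avgKernel m (c (j + 1)) x) ≤
      ENNReal.ofReal
        ((massRadius m (c j) x + massRadius m (c (j + 1)) x) * (M * R ^ (j + 1))) := by
    intro j x
    have h := lintegral_lintegral_avgKernel_le m (hc j) (hc0 j) (hc (j + 1)) (hc0 (j + 1))
      (F := fun p => ENNReal.ofReal |f p.1 - f p.2|) hH (by positivity) (hFH (j + 1)) (hA j) x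
    refine h.trans (le_of_eq ?_)
    rw [← ENNReal.ofReal_one, ← ENNReal.ofReal_add zero_le_one hA0, ← ENNReal.ofReal_mul
      (mul_nonneg (add_nonneg (hr0 _ _) (hr0 _ _)) (by positivity))]
    congr 1
    rw [hM]
    ring
  refine le_of_forall_pos_le_add fun ε hε => ?_
  obtain ⟨η, hη, hηε⟩ : ∃ η : ℝ, 0 < η ∧ 2 * η ≤ ε := ⟨ε / 2, by positivity, by linarith⟩
  obtain ⟨ε₁, hε₁, hfs⟩ := Metric.continuous_iff.1 hf s η hη
  obtain ⟨ε₂, hε₂, hft⟩ := Metric.continuous_iff.1 hf t η hη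
  obtain ⟨l, hls, hlt, hlsd, hltd⟩ := ((hfine s hs ε₁ hε₁).and ((hfine t ht ε₂ hε₂).and
    ((hfine s hs _ hd).and (hfine t ht _ hd)))).exists
  obtain ⟨k, n, rfl, hk, hkn⟩ := exists_coarsest_scale m c l s t
  set P : ℕ → ℝ := fun i => tailRadius m c (k + i) (n + 1 - i) s +
    tailRadius m c (k + i) (n + 1 - i) t with hPdef
  set z : ℕ → ℝ := fun i => massRadius m (c (k + i)) s + massRadius m (c (k + i)) t with hz
  set b : ℕ → ℝ := fun i => min (massRadius m (c (k + i)) s) (dist s t) +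
    min (massRadius m (c (k + i)) t) (dist s t) with hb
  have hP0 : ∀ i, 0 ≤ P i := fun i => add_nonneg (tailRadius_nonneg _ _ _ _)
    (tailRadius_nonneg _ _ _ _)
  have hzle : ∀ i ≤ n, z i ≤ 2 * b i + 4 * P (i + 1) := by
    intro i hi
    have hlip : massRadius m (c (k + i)) t ≤ massRadius m (c (k + i)) s + dist s t := by
      rw [dist_comm]
      exact massRadius_le_add_dist m (hc _) _ _
    have hsr := hr0 (k + i) s
    have htr := hr0 (k + i) t
    have hts := tailRadius_nonneg m (c := c) (k + (i + 1)) (n - i) s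
    have htt := tailRadius_nonneg m (c := c) (k + (i + 1)) (n - i) t
    simp only [hz, hb, hPdef, Nat.add_sub_add_right]
    rcases hi.lt_or_eq with hi | rfl
    · have h := hkn i hi
      rcases min_cases (massRadius m (c (k + i)) s) (dist s t) with ⟨h1, h2⟩ | ⟨h1, h2⟩ <;>
      rcases min_cases (massRadius m (c (k + i)) t) (dist s t) with ⟨h3, h4⟩ | ⟨h3, h4⟩ <;>
      rw [h1, h3] <;> linarith
    · rw [min_eq_left hlsd.le, min_eq_left hltd.le]
      linarith
  obtain ⟨hZ, hPZ⟩ := sum_pow_mul_le_of_le_add_tail (P := P) (z := z) (b := b) hR (n := n)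
    (fun i hi => by
      simp only [hPdef, hz]
      rw [show n + 1 - i = n - i + 1 by omega, tailRadius_succ', tailRadius_succ',
        show n + 1 - (i + 1) = n - i by omega, ← add_assoc k i 1]
      ring)
    (by simp [hPdef, tailRadius]) hP0 hzle
  have hshift : ∀ x, (∀ n, ∑ i ∈ Finset.range n,
      R ^ i * min (massRadius m (c i) x) (dist s t) ≤ 2 * τ) →
      R ^ k * ∑ i ∈ Finset.range (n + 1),
        R ^ i * min (massRadius m (c (k + i)) x) (dist s t) ≤ 2 * τ := by
    intro x hx
    have h := hx (k + (n + 1))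
    rw [Finset.sum_range_add] at h
    have h0 : 0 ≤ ∑ i ∈ Finset.range k, R ^ i * min (massRadius m (c i) x) (dist s t) :=
      Finset.sum_nonneg fun i _ => hmin0 i x
    rw [Finset.mul_sum]
    simp only [← mul_assoc, ← pow_add]
    linarith
  have hbsum : R ^ k * ∑ i ∈ Finset.range (n + 1), R ^ i * b i ≤ 4 * τ := by
    have h1 := hshift s hs
    have h2 := hshift t ht
    simp only [hb, mul_add, Finset.sum_add_distrib] at h1 h2 ⊢
    linarith
  have hkd : R ^ k * dist s t ≤ 2 * R * τ := by
    cases k with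
    | zero => nlinarith
    | succ j =>
      have h := hk j rfl
      have hts := tailRadius_nonneg m (c := c) (j + 1) (n + 1) s
      have htt := tailRadius_nonneg m (c := c) (j + 1) (n + 1) t
      have h1 := hterm s hs j
      rw [min_eq_right (by linarith)] at h1
      rw [pow_succ]
      nlinarith
  have hPk : P 0 = tailRadius m c k (n + 1) s + tailRadius m c k (n + 1) t := by simp [hPdef]
  have hpair := lintegral_chainKernel_pair_le m hc hc0 hc1 hconv
    (F := fun p => ENNReal.ofReal |f p.1 - f p.2|) hH (by positivity) (hFH (k + 1)) k n (hB k)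
    s t hk
  rw [add_assoc (dist s t), ← hPk, ← ENNReal.ofReal_one, ← ENNReal.ofReal_add zero_le_one hA0,
    ← ENNReal.ofReal_mul (mul_nonneg (add_nonneg hd.le (hP0 0)) (by positivity)), mul_assoc,
    show R ^ (k + 1) * Λ * (1 + A) = M * R ^ (k + 1) by rw [hM]; ring] at hpair
  have hmain := abs_sub_le_of_lintegral_pair_le m hc hc0 (by linarith : (3 : ℝ) ≤ R) hM0 hf hstep
    k n s t (add_nonneg hd.le (hP0 0)) hη.le
    (fun u hu => (hfs u (hu.trans_lt hls)).le) (fun u hu => (hft u (hu.trans_lt hlt)).le) hpair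
  refine hmain.trans (add_le_add ?_ hηε)
  have hRk : 0 < R ^ k := by positivity
  have h1 := mul_le_mul_of_nonneg_left hZ hRk.le
  have h2 := mul_le_mul_of_nonneg_left hPZ hRk.le
  have h3 : R ^ k * (dist s t + P 0 + 2 * ∑ i ∈ Finset.range (n + 1), R ^ i * z i) ≤
      (48 + 2 * R) * τ := by linarith
  calc _ = M * R * (R ^ k * (dist s t + P 0 + 2 * ∑ i ∈ Finset.range (n + 1), R ^ i * z i)) := by
        rw [pow_succ]; ring
    _ ≤ M * R * ((48 + 2 * R) * τ) := by gcongr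
    _ = _ := by rw [hM]; ring

end Deterministic

section Young

variable {φ : ℝ → ℝ}

lemma IsYoungFunction.nonneg (hφ : IsYoungFunction φ) {x : ℝ} (hx : 0 ≤ x) : 0 ≤ φ x := by
  have := hφ.1 Set.self_mem_Ici hx hx
  rwa [hφ.2.2.1] at this

lemma IsYoungFunction.mono (hφ : IsYoungFunction φ) {x y : ℝ} (hx : 0 ≤ x) (hxy : x ≤ y) :
    φ x ≤ φ y :=
  hφ.1 hx (hx.trans hxy) hxy

lemma IsYoungFunction.map_mul_le (hφ : IsYoungFunction φ) {a x : ℝ} (ha : 0 ≤ a) (ha1 : a ≤ 1)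
    (hx : 0 ≤ x) : φ (a * x) ≤ a * φ x := by
  have := hφ.2.1.2 hx (Set.self_mem_Ici (a := (0 : ℝ))) ha (sub_nonneg.2 ha1) (by ring)
  simpa [hφ.2.2.1] using this

lemma IsYoungFunction.one_le (hφ : IsYoungFunction φ) (hφ1 : φ 1 = 1) {x : ℝ} (hx : 1 ≤ x) :
    1 ≤ φ x :=
  hφ1 ▸ hφ.mono zero_le_one hx

lemma IsYoungFunction.le_mul_one_add_div (hφ : IsYoungFunction φ) {x y : ℝ} (hx : 0 ≤ x)
    (hy : 0 < y) (hφy : 0 < φ y) : x ≤ y * (1 + φ x / φ y) := by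
  have h0 : 0 ≤ φ x / φ y := div_nonneg (hφ.nonneg hx) hφy.le
  rcases le_total x y with h | h
  · nlinarith
  · have hx0 : 0 < x := hy.trans_le h
    have h1 := hφ.map_mul_le (div_nonneg hy.le hx) ((div_le_one hx0).2 h) hx
    rw [div_mul_cancel₀ _ hx0.ne', div_mul_eq_mul_div, le_div_iff₀ hx0] at h1
    have h2 : x ≤ y * (φ x / φ y) := by
      rw [← mul_div_assoc, le_div_iff₀ hφy]
      linarith
    linarith

lemma IsYoungFunction.ofReal_le_yinv (hφ : IsYoungFunction φ) {x : ℝ} {y : ℝ≥0∞}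
    (h : ENNReal.ofReal (φ x) < y) : ENNReal.ofReal x ≤ yinv φ y := by
  refine le_sInf ?_
  rintro _ ⟨r, hr, rfl, hy⟩
  refine ENNReal.ofReal_le_ofReal ?_
  by_contra! hrx
  exact absurd (hy.trans (ENNReal.ofReal_le_ofReal (hφ.mono hr hrx.le))) (not_le.2 h)

lemma IsYoungFunction.one_le_yinv (hφ : IsYoungFunction φ) (hφ1 : φ 1 = 1) {y : ℝ≥0∞}
    (hy : 1 ≤ y) : 1 ≤ yinv φ y := by
  refine le_sInf ?_
  rintro _ ⟨r, hr, rfl, hyr⟩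
  rw [ENNReal.one_le_ofReal]
  by_contra! hr1
  have h1 := ENNReal.one_le_ofReal.1 (hy.trans hyr)
  have h2 := hφ.map_mul_le hr hr1.le zero_le_one
  rw [mul_one, hφ1] at h2
  linarith

lemma sum_ofReal_pow_le {R : ℝ} (hR : 2 ≤ R) (S : Finset ℕ) {y : ℝ≥0∞}
    (h : ∀ k ∈ S, ENNReal.ofReal (R ^ k) ≤ y) : ∑ k ∈ S, ENNReal.ofReal (R ^ k) ≤ 2 * y := by
  have hR0 : 0 < R := by linarith
  have hgeom : ∀ n : ℕ, ∑ k ∈ Finset.range (n + 1), R ^ k ≤ 2 * R ^ n := by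
    intro n
    induction n with
    | zero => simp
    | succ n ih =>
      rw [Finset.sum_range_succ, pow_succ R n]
      have := pow_pos hR0 n
      nlinarith
  rcases S.eq_empty_or_nonempty with rfl | hS
  · simp
  · have hsub : S ⊆ Finset.range (S.max' hS + 1) := fun k hk =>
      Finset.mem_range_succ_iff.2 (S.le_max' k hk)
    calc ∑ k ∈ S, ENNReal.ofReal (R ^ k)
        ≤ ∑ k ∈ Finset.range (S.max' hS + 1), ENNReal.ofReal (R ^ k) :=
          Finset.sum_le_sum_of_subset hsub
      _ = ENNReal.ofReal (∑ k ∈ Finset.range (S.max' hS + 1), R ^ k) :=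
          (ENNReal.ofReal_sum_of_nonneg fun k _ => by positivity).symm
      _ ≤ ENNReal.ofReal (2 * R ^ S.max' hS) := ENNReal.ofReal_le_ofReal (hgeom _)
      _ = 2 * ENNReal.ofReal (R ^ S.max' hS) := by
          rw [ENNReal.ofReal_mul zero_le_two, ENNReal.ofReal_ofNat]
      _ ≤ 2 * y := by
          gcongr
          exact h _ (S.max'_mem hS)

end Young

section MinorizingMetric

variable {T : Type*} [MetricSpace T] [MeasurableSpace T] (m : Measure T) {φ : ℝ → ℝ}

lemma sum_pow_mul_min_massRadius_le (hφ : IsYoungFunction φ) {R : ℝ} (hR : 2 ≤ R) (x : T)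
    (d : ℝ) (n : ℕ) :
    ∑ k ∈ Finset.range n,
      ENNReal.ofReal (R ^ k * min (massRadius m (ENNReal.ofReal (φ (R ^ k)))⁻¹ x) d) ≤
      2 * ∫⁻ ε in Set.Ioc 0 d, yinv φ (1 / m (closedBall x ε)) := by
  classical
  set ρ : ℕ → ℝ := fun k => massRadius m (ENNReal.ofReal (φ (R ^ k)))⁻¹ x with hρ
  have hR0 : 0 < R := by linarith
  have hk : ∀ k, ENNReal.ofReal (R ^ k * min (ρ k) d) ≤
      ∫⁻ ε in Set.Ioc 0 d, (Set.Iio (ρ k)).indicator (fun _ => ENNReal.ofReal (R ^ k)) ε := by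
    intro k
    rw [lintegral_indicator_const measurableSet_Iio, ENNReal.ofReal_mul (by positivity),
      Measure.restrict_apply measurableSet_Iio]
    gcongr
    calc ENNReal.ofReal (min (ρ k) d) = volume (Set.Ioo 0 (min (ρ k) d)) := by simp
      _ ≤ volume (Set.Iio (ρ k) ∩ Set.Ioc 0 d) := measure_mono fun ε hε =>
        ⟨hε.2.trans_le (min_le_left _ _), hε.1, (hε.2.trans_le (min_le_right _ _)).le⟩
  refine (Finset.sum_le_sum fun k _ => hk k).trans ?_
  rw [← lintegral_finsetSum _ fun k _ => measurable_const.indicator measurableSet_Iio,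
    ← lintegral_const_mul' _ _ ENNReal.ofNat_ne_top]
  refine setLIntegral_mono' measurableSet_Ioc fun ε hε => ?_
  simp only [Set.indicator_apply, Set.mem_Iio]
  rw [← Finset.sum_filter]
  refine sum_ofReal_pow_le hR _ fun k hk => hφ.ofReal_le_yinv ?_
  have h := measure_closedBall_lt_of_lt_massRadius hε.1.le (Finset.mem_filter.1 hk).2
  rw [one_div]
  exact ENNReal.lt_inv_iff_lt_inv.1 h

lemma ofReal_dist_le_tauDist [IsProbabilityMeasure m] (hφ : IsYoungFunction φ) (hφ1 : φ 1 = 1)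
    (s t : T) : ENNReal.ofReal (dist s t) ≤ tauDist m φ s t := by
  refine le_max_of_le_left ?_
  calc ENNReal.ofReal (dist s t) = ∫⁻ _ in Set.Ioc (0 : ℝ) (dist s t), 1 := by simp
    _ ≤ _ := lintegral_mono fun ε => hφ.one_le_yinv hφ1 (by simpa using prob_le_one)

lemma dist_le_toReal_tauDist [IsProbabilityMeasure m] (hφ : IsYoungFunction φ) (hφ1 : φ 1 = 1)
    {s t : T} (hτ : tauDist m φ s t ≠ ∞) : dist s t ≤ (tauDist m φ s t).toReal :=
  (ENNReal.ofReal_le_iff_le_toReal hτ).1 (ofReal_dist_le_tauDist m hφ hφ1 s t)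

lemma sum_pow_mul_min_massRadius_le_tauDist (hφ : IsYoungFunction φ) {R : ℝ} (hR : 2 ≤ R)
    {s t x : T} (hx : x = s ∨ x = t) (hτ : tauDist m φ s t ≠ ∞) (n : ℕ) :
    ∑ k ∈ Finset.range n,
      R ^ k * min (massRadius m (ENNReal.ofReal (φ (R ^ k)))⁻¹ x) (dist s t) ≤
      2 * (tauDist m φ s t).toReal := by
  have hle : ∫⁻ ε in Set.Ioc 0 (dist s t), yinv φ (1 / m (closedBall x ε)) ≤ tauDist m φ s t := by
    rcases hx with rfl | rfl
    exacts [le_max_left _ _, le_max_right _ _]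
  have h := (sum_pow_mul_min_massRadius_le m hφ hR x (dist s t) n).trans
    (mul_le_mul_right hle 2)
  rw [← ENNReal.ofReal_sum_of_nonneg fun k _ => mul_nonneg (pow_nonneg (by linarith) _)
      (le_min (massRadius_nonneg _ _ _) dist_nonneg),
    ENNReal.ofReal_le_iff_le_toReal (ENNReal.mul_ne_top ENNReal.ofNat_ne_top hτ),
    ENNReal.toReal_mul, ENNReal.toReal_ofNat] at h
  exact h

end MinorizingMetric

section Domination

variable {T : Type*} [MetricSpace T]

lemma fdiv_nonneg (f : T → ℝ) (p : T × T) : 0 ≤ fdiv f p :=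
  div_nonneg (abs_nonneg _) dist_nonneg

lemma fdiv_const_mul (f : T → ℝ) {a : ℝ} (ha : 0 ≤ a) (p : T × T) :
    fdiv (fun u => a * f u) p = a * fdiv f p := by
  rw [fdiv, fdiv, ← mul_sub, abs_mul, abs_of_nonneg ha, mul_div_assoc]

lemma dist_mul_fdiv (f : T → ℝ) (p : T × T) : dist p.1 p.2 * fdiv f p = |f p.1 - f p.2| := by
  rcases eq_or_ne p.1 p.2 with h | h
  · simp [h]
  · rw [fdiv, mul_div_cancel₀ _ (dist_pos.2 h).ne']

lemma IsYoungFunction.measurable_comp {ψ : ℝ → ℝ} (hψ : IsYoungFunction ψ) {α : Type*}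
    [MeasurableSpace α] {g : α → ℝ} (hg : Measurable g) (hg0 : ∀ a, 0 ≤ g a) :
    Measurable fun a => ψ (g a) := by
  have h : Monotone fun x : ℝ => ψ (max 0 x) := fun x y hxy =>
    hψ.mono (le_max_left _ _) (max_le_max_left 0 hxy)
  have h' := h.measurable.comp hg
  simpa only [Function.comp_def, max_eq_right (hg0 _)] using h'

variable [CompactSpace T] [MeasurableSpace T] [BorelSpace T]

lemma Continuous.measurable_fdiv {f : T → ℝ} (hf : Continuous f) : Measurable (fdiv f) := by
  have := hf.measurable
  unfold fdiv
  fun_prop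

lemma exists_measure_abs_sub_le (m : Measure T) [IsProbabilityMeasure m] {φ ψ : ℝ → ℝ}
    (hφ : IsYoungFunction φ) (hψ : IsYoungFunction ψ) (hφ1 : φ 1 = 1) (hψ1 : ψ 1 = 1)
    {R : ℝ} (hR : 10 ≤ R) {n₀ : ℕ}
    (hconv : ∀ k : ℕ, φ (R ^ (k + 1)) * φ (R ^ (k + 1)) ≤ φ (R ^ (k + 2)) * φ (R ^ k))
    (hsum : Summable fun k : ℕ => φ (R ^ (k + 1)) / ψ (R ^ (k + 1 + n₀))) :
    ∃ ν : Measure (T × T),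
      ν Set.univ ≤ ENNReal.ofReal (2 * ∑' k : ℕ, φ (R ^ (k + 1)) / ψ (R ^ (k + 1 + n₀))) ∧
      ∀ f : T → ℝ, Continuous f → ∀ A : ℝ, 0 ≤ A →
        ∫⁻ p, ENNReal.ofReal (ψ (fdiv f p)) ∂ν ≤ ENNReal.ofReal A →
        ∀ s t, s ≠ t → tauDist m φ s t ≠ ∞ →
          |f s - f t| ≤ (48 + 2 * R) * R * R ^ n₀ * (1 + A) * (tauDist m φ s t).toReal := by
  have hR1 : 1 ≤ R := by linarith
  have hφp : ∀ k : ℕ, 1 ≤ φ (R ^ k) := fun k => hφ.one_le hφ1 (one_le_pow₀ hR1)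
  have hψp : ∀ k : ℕ, 1 ≤ ψ (R ^ k) := fun k => hψ.one_le hψ1 (one_le_pow₀ hR1)
  set b : ℕ → ℝ := fun k => φ (R ^ (k + 1)) / ψ (R ^ (k + 1 + n₀)) with hb
  have hb0 : ∀ k, 0 ≤ b k := fun k =>
    div_nonneg (zero_le_one.trans (hφp _)) (zero_le_one.trans (hψp _))
  set c : ℕ → ℝ≥0∞ := fun k => (ENNReal.ofReal (φ (R ^ k)))⁻¹ with hcdef
  have hc : ∀ k, c k ≤ 1 := fun k => ENNReal.inv_le_one.2 (ENNReal.one_le_ofReal.2 (hφp k))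
  have hc0 : ∀ k, c k ≠ 0 := fun k => ENNReal.inv_ne_zero.2 ENNReal.ofReal_ne_top
  have hcinv : ∀ k, (c k)⁻¹ = ENNReal.ofReal (φ (R ^ k)) := fun k => inv_inv _
  set w : ℕ → T × T → ℝ≥0∞ := fun k p =>
    ENNReal.ofReal (b k) * (massDensity m (c k) p + pairWeight m c k p) with hw
  have hwm : ∀ k, Measurable (w k) := fun k =>
    ((measurable_massDensity m (hc k)).add (measurable_pairWeight m hc k)).const_mul _
  have hWm : Measurable fun p => ∑' k, w k p := Measurable.tsum hwm
  refine ⟨(m.prod m).withDensity fun p => ∑' k, w k p, ?_, fun f hf A hA hfA s t hst hτ => ?_⟩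
  · rw [withDensity_apply _ MeasurableSet.univ, Measure.restrict_univ,
      lintegral_tsum fun k => (hwm k).aemeasurable, ← tsum_mul_left,
      ENNReal.ofReal_tsum_of_nonneg (fun k => mul_nonneg zero_le_two (hb0 k)) (hsum.mul_left 2)]
    refine ENNReal.tsum_le_tsum fun k => ?_
    simp only [hw]
    rw [lintegral_const_mul' _ _ ENNReal.ofReal_ne_top,
      lintegral_add_left (measurable_massDensity m (hc k)),
      lintegral_massDensity_prod m (hc k) (hc0 k), mul_comm (2 : ℝ), ENNReal.ofReal_mul (hb0 k),
      ENNReal.ofReal_ofNat, ← one_add_one_eq_two]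
    gcongr
    exact lintegral_pairWeight_le m hc k
  · have hH : Measurable fun p => ENNReal.ofReal (ψ (fdiv f p)) :=
      (hψ.measurable_comp hf.measurable_fdiv (fdiv_nonneg f)).ennreal_ofReal
    rw [lintegral_withDensity_eq_lintegral_mul _ hWm hH] at hfA
    set q : ℕ → ℝ≥0∞ := fun k => (ENNReal.ofReal (ψ (R ^ k * R ^ n₀)))⁻¹ with hq
    have hqc : ∀ k, q (k + 1) * (c (k + 1))⁻¹ = ENNReal.ofReal (b k) := by
      intro k
      rw [hcinv, hq, hb]
      simp only
      rw [← pow_add, ENNReal.ofReal_div_of_pos (zero_lt_one.trans_le (hψp _)), div_eq_mul_inv,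
        mul_comm]
    have hweight : ∀ (k : ℕ) (v : T × T → ℝ≥0∞),
        (∀ p, ENNReal.ofReal (b k) * v p ≤ w k p) →
        q (k + 1) * ((c (k + 1))⁻¹ * ∫⁻ p, v p * ENNReal.ofReal (ψ (fdiv f p)) ∂(m.prod m)) ≤
          ENNReal.ofReal A := by
      intro k v hv
      rw [← mul_assoc, hqc, ← lintegral_const_mul' _ _ ENNReal.ofReal_ne_top]
      refine (lintegral_mono fun p => ?_).trans hfA
      rw [← mul_assoc]
      exact mul_le_mul_left ((hv p).trans (ENNReal.le_tsum k)) _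
    refine abs_sub_le_of_sum_min_le m hc hc0 (by simp [hcdef, hφ1]) (fun k => ?_) hR
      (by positivity) hA hf hH (q := q) (fun k p => ?_) (fun k => hweight k _ fun p => ?_)
      (fun k => hweight k _ fun p => ?_) hst (dist_le_toReal_tauDist m hφ hφ1 hτ)
      (fun n => sum_pow_mul_min_massRadius_le_tauDist m hφ (by linarith) (.inl rfl) hτ n)
      (fun n => sum_pow_mul_min_massRadius_le_tauDist m hφ (by linarith) (.inr rfl) hτ n)
    · simp only [hcinv]
      rw [← ENNReal.ofReal_mul (zero_le_one.trans (hφp _)),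
        ← ENNReal.ofReal_mul (zero_le_one.trans (hφp _))]
      exact ENNReal.ofReal_le_ofReal (hconv k)
    · have hψk : 0 < ψ (R ^ k * R ^ n₀) := by
        rw [← pow_add]
        exact zero_lt_one.trans_le (hψp _)
      rw [mul_comm (q k), hq, ← div_eq_mul_inv, ← ENNReal.ofReal_div_of_pos hψk,
        ← ENNReal.ofReal_one, ← ENNReal.ofReal_add zero_le_one
          (div_nonneg (hψ.nonneg (fdiv_nonneg f p)) hψk.le),
        ← ENNReal.ofReal_mul (by positivity), ← dist_mul_fdiv f p, mul_assoc]
      gcongr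
      exact hψ.le_mul_one_add_div (fdiv_nonneg f p) (by positivity) hψk
    · exact mul_le_mul_right le_self_add _
    · exact mul_le_mul_right le_add_self _

end Domination

section SuperMultiplicative

variable {ψ : ℝ → ℝ}

lemma IsYoungFunction.div_mul_le (hψ : IsYoungFunction ψ) (hψ1 : ψ 1 = 1) {r : ℝ} (hr : 0 < r)
    (hψr : ∀ x y : ℝ, 1 ≤ x → 1 ≤ y → ψ x * ψ y ≤ ψ (r * x * y)) {x y : ℝ} (hx : 0 ≤ x)
    (hy : 1 ≤ y) : ψ (x / (r * y)) ≤ 1 + ψ x / ψ y := by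
  have hy0 : 0 < y := zero_lt_one.trans_le hy
  have hψy : 0 < ψ y := zero_lt_one.trans_le (hψ.one_le hψ1 hy)
  rcases le_total (x / (r * y)) 1 with h | h
  · have h1 := hψ.mono (by positivity) h
    have h2 := div_nonneg (hψ.nonneg hx) hψy.le
    linarith
  · have h1 := hψr _ y h hy
    rw [show r * (x / (r * y)) * y = x by field_simp, ← le_div_iff₀ hψy] at h1
    linarith

variable {T : Type*} [MetricSpace T] [MeasurableSpace T]

lemma ofReal_map_abs_sub_div_le (hψ : IsYoungFunction ψ) (hψ1 : ψ 1 = 1) {r : ℝ} (hr : 0 < r)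
    (hψr : ∀ x y : ℝ, 1 ≤ x → 1 ≤ y → ψ x * ψ y ≤ ψ (r * x * y))
    {ν : Measure (T × T)} {N C τ : ℝ} (hN : 0 ≤ N) (hν : ν Set.univ ≤ ENNReal.ofReal N)
    (hC : 0 < C) (hτ : 0 < τ) {s t : T}
    (hbound : ∀ f : T → ℝ, Continuous f → ∀ A : ℝ, 0 ≤ A →
      ∫⁻ p, ENNReal.ofReal (ψ (fdiv f p)) ∂ν ≤ ENNReal.ofReal A →
        |f s - f t| ≤ C * (1 + A) * τ) {f : T → ℝ} (hf : Continuous f) :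
    ENNReal.ofReal (ψ (|f s - f t| / (C * r * (2 + N) * τ))) ≤
      1 + ∫⁻ p, ENNReal.ofReal (ψ (fdiv f p)) ∂ν := by
  by_contra! h
  set I := ∫⁻ p, ENNReal.ofReal (ψ (fdiv f p)) ∂ν with hI
  set z := |f s - f t| / (C * r * (2 + N) * τ) with hz
  have hz0 : 0 ≤ z := by positivity
  have hItop : I ≠ ∞ := fun hI => by simp [hI] at h
  obtain ⟨A, hA, hIA⟩ : ∃ A : ℝ, 0 ≤ A ∧ I = ENNReal.ofReal A :=
    ⟨I.toReal, ENNReal.toReal_nonneg, (ENNReal.ofReal_toReal hItop).symm⟩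
  rw [hIA, ← ENNReal.ofReal_one, ← ENNReal.ofReal_add zero_le_one hA,
    ENNReal.ofReal_lt_ofReal_iff_of_nonneg (by positivity)] at h
  have hz1 : 1 ≤ z := by
    by_contra! hlt
    have := hψ.mono hz0 hlt.le
    linarith
  have hψz : 0 < ψ z := by linarith
  have hrz : 0 < r * z := by positivity
  have hint : ∫⁻ p, ENNReal.ofReal (ψ (fdiv (fun u => (r * z)⁻¹ * f u) p)) ∂ν ≤
      ENNReal.ofReal (N + A / ψ z) := by
    calc _ ≤ ∫⁻ p, (1 + ENNReal.ofReal (ψ z)⁻¹ * ENNReal.ofReal (ψ (fdiv f p))) ∂ν := by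
          refine lintegral_mono fun p => ?_
          have h1 := hψ.div_mul_le hψ1 hr hψr (fdiv_nonneg f p) hz1
          simp only
          rw [fdiv_const_mul f (inv_nonneg.2 hrz.le), inv_mul_eq_div,
            ← ENNReal.ofReal_mul (inv_nonneg.2 hψz.le), ← ENNReal.ofReal_one,
            ← ENNReal.ofReal_add zero_le_one
              (mul_nonneg (inv_nonneg.2 hψz.le) (hψ.nonneg (fdiv_nonneg f p))),
            inv_mul_eq_div]
          exact ENNReal.ofReal_le_ofReal h1
      _ = ν Set.univ + ENNReal.ofReal (ψ z)⁻¹ * ENNReal.ofReal A := by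
          rw [lintegral_add_left measurable_const, lintegral_const_mul' _ _ ENNReal.ofReal_ne_top,
            ← hIA, lintegral_one]
      _ ≤ _ := by
          rw [← ENNReal.ofReal_mul (inv_nonneg.2 hψz.le), inv_mul_eq_div,
            ENNReal.ofReal_add hN (by positivity)]
          gcongr
  have hmain := hbound _ (hf.const_mul _) _ (by positivity) hint
  have hval : |(r * z)⁻¹ * f s - (r * z)⁻¹ * f t| = C * (2 + N) * τ := by
    have hfst : |f s - f t| = z * (C * r * (2 + N) * τ) := by
      rw [hz, div_mul_cancel₀]
      positivity
    rw [← mul_sub, abs_mul, abs_of_pos (inv_pos.2 hrz), hfst]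
    have hzne : z ≠ 0 := by positivity
    field_simp
  rw [hval] at hmain
  have h2 := le_of_mul_le_mul_left (le_of_mul_le_mul_right hmain hτ) hC
  have h3 : A / ψ z < 1 := (div_lt_one hψz).2 (by linarith)
  linarith

variable [CompactSpace T] [BorelSpace T]

lemma lintegral_lintegral_fdiv_le (hψ : IsYoungFunction ψ) {Ω : Type*} [MeasurableSpace Ω]
    (P : Measure Ω) [SFinite P] (ν : Measure (T × T)) [SFinite ν] {X : Ω → T → ℝ}
    (hXm : ∀ t, Measurable fun ω => X ω t) (hXc : ∀ ω, Continuous (X ω))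
    (hX : ∀ s t, s ≠ t → ∫⁻ ω, ENNReal.ofReal (ψ (|X ω s - X ω t| / dist s t)) ∂P ≤ 1) :
    ∫⁻ ω, ∫⁻ p, ENNReal.ofReal (ψ (fdiv (X ω) p)) ∂ν ∂P ≤ ν Set.univ := by
  have hjoint : Measurable fun p : Ω × T => X p.1 p.2 :=
    (measurable_uncurry_of_continuous_of_measurable (u := fun t ω => X ω t) hXc hXm).comp
      measurable_swap
  have hfd : Measurable fun p : Ω × T × T => fdiv (X p.1) p.2 := by
    have h1 : Measurable fun p : Ω × T × T => X p.1 p.2.1 :=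
      hjoint.comp (measurable_fst.prodMk measurable_snd.fst)
    have h2 : Measurable fun p : Ω × T × T => X p.1 p.2.2 :=
      hjoint.comp (measurable_fst.prodMk measurable_snd.snd)
    have h3 : Measurable fun p : Ω × T × T => dist p.2.1 p.2.2 := by fun_prop
    exact (continuous_abs.measurable.comp (h1.sub h2)).div h3
  rw [lintegral_lintegral_swap
    (hψ.measurable_comp hfd fun p => fdiv_nonneg _ _).ennreal_ofReal.aemeasurable, ← lintegral_one]
  refine lintegral_mono fun p => ?_
  rcases eq_or_ne p.1 p.2 with h | h
  · simp [fdiv, h, hψ.2.2.1]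
  · exact hX p.1 p.2 h

end SuperMultiplicative

lemma mul_self_le_of_ratio_mono {a : ℕ → ℝ} (ha : ∀ n, 0 < a n)
    (h : ∀ n, a (n + 1) / a n ≤ a (n + 2) / a (n + 1)) (n j : ℕ) :
    a (n + j) * a (n + j) ≤ a (n + j + j) * a n := by
  have hmono : Monotone fun n => a (n + 1) / a n := monotone_nat_of_le_succ h
  have key : ∀ i, a (n + i) * a (n + j) ≤ a (n + j + i) * a n := by
    intro i
    induction i with
    | zero => rw [add_zero, add_zero, mul_comm]
    | succ i ih =>
      have h1 : a (n + i + 1) / a (n + i) ≤ a (n + j + i + 1) / a (n + j + i) :=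
        hmono (by omega)
      have h2 := mul_le_mul h1 ih (mul_pos (ha _) (ha _)).le (div_pos (ha _) (ha _)).le
      have h3 := (ha (n + i)).ne'
      have h4 := (ha (n + j + i)).ne'
      calc a (n + (i + 1)) * a (n + j)
          = a (n + i + 1) / a (n + i) * (a (n + i) * a (n + j)) := by
            rw [← add_assoc]; field_simp
        _ ≤ _ := h2
        _ = _ := by rw [← add_assoc]; field_simp
  exact key j

lemma exists_const_of_scale {φ ψ : ℝ → ℝ} (hφ : IsYoungFunction φ) (hψ : IsYoungFunction ψ)
    (hφ1 : φ 1 = 1) (hψ1 : ψ 1 = 1) {R : ℝ} (hR : 10 ≤ R) {n₀ : ℕ}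
    (hconv : ∀ k : ℕ, φ (R ^ (k + 1)) * φ (R ^ (k + 1)) ≤ φ (R ^ (k + 2)) * φ (R ^ k))
    (hsum : Summable fun k : ℕ => φ (R ^ (k + 1)) / ψ (R ^ (k + 1 + n₀)))
    {r : ℝ} (hr : 0 < r) (hψr : ∀ x y : ℝ, 1 ≤ x → 1 ≤ y → ψ x * ψ y ≤ ψ (r * x * y)) :
    ∃ K : ℝ, 0 < K ∧
      ∀ (T : Type) [MetricSpace T] [CompactSpace T] [MeasurableSpace T] [BorelSpace T]
        (m : Measure T), IsProbabilityMeasure m →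
          ∀ (Ω : Type) [MeasurableSpace Ω] (P : Measure Ω), IsProbabilityMeasure P →
            ∀ X : Ω → T → ℝ,
              (∀ t : T, Measurable fun ω => X ω t) →
              (∀ ω : Ω, Continuous (X ω)) →
              (∀ s t : T, s ≠ t →
                ∫⁻ ω, ENNReal.ofReal (ψ (|X ω s - X ω t| / dist s t)) ∂P ≤ 1) →
              ∫⁻ ω, ⨆ s, ⨆ t, ⨆ (_ : s ≠ t),
                  ENNReal.ofReal
                    (ψ (|X ω s - X ω t| /
                      (2 * K * (tauDist m φ s t).toReal))) ∂P ≤ 1 := by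
  have hR1 : 1 ≤ R := by linarith
  set N : ℝ := 2 * ∑' k : ℕ, φ (R ^ (k + 1)) / ψ (R ^ (k + 1 + n₀)) with hNdef
  have hN : 0 ≤ N := mul_nonneg zero_le_two (tsum_nonneg fun k =>
    div_nonneg (hφ.nonneg (by positivity)) (hψ.nonneg (by positivity)))
  set C : ℝ := (48 + 2 * R) * R * R ^ n₀ with hC
  have hC0 : 0 < C := by positivity
  refine ⟨C * r * (2 + N) * (1 + N) / 2, by positivity, ?_⟩
  intro T _ _ _ _ m _ Ω _ P _ X hXm hXc hX
  obtain ⟨ν, hν, hbound⟩ := exists_measure_abs_sub_le m hφ hψ hφ1 hψ1 hR hconv hsum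
  have : IsFiniteMeasure ν := ⟨hν.trans_lt ENNReal.ofReal_lt_top⟩
  have hpt : ∀ ω s t, s ≠ t → ENNReal.ofReal (ψ (|X ω s - X ω t| /
      (2 * (C * r * (2 + N) * (1 + N) / 2) * (tauDist m φ s t).toReal))) ≤
      ENNReal.ofReal (1 + N)⁻¹ * (1 + ∫⁻ p, ENNReal.ofReal (ψ (fdiv (X ω) p)) ∂ν) := by
    intro ω s t hst
    rcases eq_or_ne (tauDist m φ s t) ∞ with hτ | hτ
    · simp [hτ, hψ.2.2.1]
    · have hτ0 := (dist_pos.2 hst).trans_le (dist_le_toReal_tauDist m hφ hφ1 hτ)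
      have h := ofReal_map_abs_sub_div_le hψ hψ1 hr hψr hN hν hC0 hτ0
        (fun f hf A hA hfA => hbound f hf A hA hfA s t hst hτ) (hXc ω)
      refine le_trans ?_ (mul_le_mul_right h _)
      rw [← ENNReal.ofReal_mul (by positivity)]
      refine ENNReal.ofReal_le_ofReal (le_trans (le_of_eq ?_)
        (hψ.map_mul_le (by positivity) (inv_le_one_of_one_le₀ (by linarith)) (by positivity)))
      congr 1
      field_simp
  calc _ ≤ ∫⁻ ω, ENNReal.ofReal (1 + N)⁻¹ *
        (1 + ∫⁻ p, ENNReal.ofReal (ψ (fdiv (X ω) p)) ∂ν) ∂P :=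
        lintegral_mono fun ω => iSup_le fun s => iSup_le fun t => iSup_le (hpt ω s t)
    _ = ENNReal.ofReal (1 + N)⁻¹ *
        (1 + ∫⁻ ω, ∫⁻ p, ENNReal.ofReal (ψ (fdiv (X ω) p)) ∂ν ∂P) := by
        rw [lintegral_const_mul' _ _ ENNReal.ofReal_ne_top, lintegral_add_left measurable_const,
          lintegral_one, measure_univ]
    _ ≤ ENNReal.ofReal (1 + N)⁻¹ * (1 + ENNReal.ofReal N) := by
        gcongr
        exact (lintegral_lintegral_fdiv_le hψ P ν hXm hXc hX).trans hν
    _ = 1 := by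
        rw [← ENNReal.ofReal_one, ← ENNReal.ofReal_add zero_le_one hN,
          ← ENNReal.ofReal_mul (by positivity), inv_mul_cancel₀ (by positivity)]

/-- second part of Corollary 1 of the paper. -/
theorem statement3 (φ ψ : ℝ → ℝ) (hφ : IsYoungFunction φ) (hψ : IsYoungFunction ψ)
    (hφ1 : φ 1 = 1) (hψ1 : ψ 1 = 1) (R : ℝ) (hR : 1 < R) (n₀ : ℕ) (hn₀ : 1 ≤ n₀)
    (hmiau : ∀ k : ℕ, 1 ≤ k → φ (R ^ k) / φ (R ^ (k + 1)) ≤ φ (R ^ (k - 1)) / φ (R ^ k))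
    (hpap : Summable fun k : ℕ => φ (R ^ k) / ψ (R ^ (k + n₀)))
    (r : ℝ) (hr : 1 < r)
    (hψr : ∀ x y : ℝ, 1 ≤ x → 1 ≤ y → ψ x * ψ y ≤ ψ (r * x * y)) :
    ∃ K : ℝ, 0 < K ∧
      ∀ (T : Type) [MetricSpace T] [CompactSpace T] [MeasurableSpace T] [BorelSpace T]
        (m : Measure T), IsProbabilityMeasure m →
          ∀ (Ω : Type) [MeasurableSpace Ω] (P : Measure Ω), IsProbabilityMeasure P →
            ∀ X : Ω → T → ℝ,
              (∀ t : T, Measurable fun ω => X ω t) →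
              (∀ ω : Ω, Continuous (X ω)) →
              (∀ s t : T, s ≠ t →
                ∫⁻ ω, ENNReal.ofReal (ψ (|X ω s - X ω t| / dist s t)) ∂P ≤ 1) →
              ∫⁻ ω, ⨆ s, ⨆ t, ⨆ (_ : s ≠ t),
                  ENNReal.ofReal
                    (ψ (|X ω s - X ω t| /
                      (2 * K * (tauDist m φ s t).toReal))) ∂P ≤ 1 := by
  have hφp : ∀ k : ℕ, 1 ≤ φ (R ^ k) := fun k => hφ.one_le hφ1 (one_le_pow₀ hR.le)
  have hψp : ∀ k : ℕ, 1 ≤ ψ (R ^ k) := fun k => hψ.one_le hψ1 (one_le_pow₀ hR.le)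
  obtain ⟨j, hj⟩ := pow_unbounded_of_one_lt 10 hR
  have hj0 : j ≠ 0 := by
    rintro rfl
    norm_num at hj
  refine exists_const_of_scale hφ hψ hφ1 hψ1 hj.le (n₀ := n₀) (fun k => ?_) ?_
    (zero_lt_one.trans hr) hψr
  · have h := mul_self_le_of_ratio_mono (a := fun n => φ (R ^ n))
      (fun n => zero_lt_one.trans_le (hφp n)) (fun n => ?_) (j * k) j
    · simpa only [← pow_mul, mul_add, mul_one, mul_two, ← add_assoc] using h
    · have h := hmiau (n + 1) n.succ_pos
      rw [Nat.add_sub_cancel] at h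
      have h1 := zero_lt_one.trans_le (hφp n)
      have h2 := zero_lt_one.trans_le (hφp (n + 1))
      have h3 := zero_lt_one.trans_le (hφp (n + 1 + 1))
      rw [div_le_div_iff₀ h3 h2] at h
      rw [div_le_div_iff₀ h1 h2]
      linarith
  · have hinj : Function.Injective fun k : ℕ => j * (k + 1) := fun a b hab => by
      simpa [hj0] using hab
    refine Summable.of_nonneg_of_le (fun k => ?_) (fun k => ?_) (hpap.comp_injective hinj)
    · simp only [← pow_mul]
      exact div_nonneg (zero_le_one.trans (hφp _)) (zero_le_one.trans (hψp _))
    · simp only [← pow_mul, Function.comp_apply]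
      refine div_le_div_of_nonneg_left (zero_le_one.trans (hφp _))
        (zero_lt_one.trans_le (hψp _)) (hψ.mono (by positivity) (pow_le_pow_right₀ hR.le ?_))
      rw [mul_add j (k + 1) n₀]
      exact Nat.add_le_add_left (Nat.le_mul_of_pos_left n₀ (Nat.pos_of_ne_zero hj0)) _
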